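/- arXiv:2504.18862 — 3 statements merged into one kernel-verified Lean document; each statement's English description precedes it below -/
import Mathlib

section
/- Let k ∈ {3,4,5} and ε > 0. There is a constant C > 0 such that for every real y ≥ 2, |∑_{i ∈ {0,1}^{k−1}} cos(πβ(i)/4) · ∑_{n₁ ≤ y, …, n_k ≤ y, α(n;i)=0} c_{n₁}⋯c_{n_k}/(n₁⋯n_k)^{7/8} − B_k(c)| ≤ C · y^{−3/4+ε}. Consequently, for S₁(x) = x^{9k/8} ∑_{i ∈ {0,1}^{k−1}} cos(−πβ(i)/4) ∑_{n₁ ≤ y, …, n_k ≤ y, α(n;i)=0} c_{n₁}⋯c_{n_k}/(n₁⋯n_k)^{7/8}, one has ∫_T^{2T} S₁(x) dx = B_k(c) ∫_T^{2T} x^{9k/8} dx + O(T^{1+9k/8+ε} y^{−3/4}) uniformly for T ≥ 10 and 2 ≤ y ≤ T. -/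
open scoped Classical
open Real Finset

/-- `α(n; i) = n₁^{1/4} + (−1)^{i₁} n₂^{1/4} + ⋯ + (−1)^{i_{k−1}} n_k^{1/4}`, encoded with a sign
bit for every index; the leading `+1` sign corresponds to the hypothesis `i 0 = false`. -/
noncomputable def alphaRS {k : ℕ} (n : Fin k → ℕ) (i : Fin k → Bool) : ℝ :=
  ∑ j, (if i j then (-1 : ℝ) else 1) * (n j : ℝ) ^ ((1 : ℝ) / 4)

/-- `β(i) = 1 + (−1)^{i₁} + ⋯ + (−1)^{i_{k−1}}`. -/
noncomputable def betaRS {k : ℕ} (i : Fin k → Bool) : ℝ :=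
  ∑ j, (if i j then (-1 : ℝ) else 1)

/-- `s_{k;l}(c) = ∑ c_{n₁}⋯c_{n_k}/(n₁⋯n_k)^{7/8}` over positive integer tuples with
`n₁^{1/4}+⋯+n_l^{1/4} = n_{l+1}^{1/4}+⋯+n_k^{1/4}`. -/
noncomputable def sklRS (c : ℕ → ℝ) (k l : ℕ) : ℝ :=
  ∑' n : {n : Fin k → ℕ // (∀ j, 0 < n j) ∧
      ∑ j ∈ Finset.univ.filter (fun j : Fin k => (j : ℕ) < l), ((n j : ℝ)) ^ ((1 : ℝ) / 4) =
        ∑ j ∈ Finset.univ.filter (fun j : Fin k => l ≤ (j : ℕ)), ((n j : ℝ)) ^ ((1 : ℝ) / 4)},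
    (∏ j, c (n.1 j)) / (∏ j, (n.1 j : ℝ)) ^ ((7 : ℝ) / 8)

/-- `B_k(c) = ∑_{l=1}^{k−1} binom(k−1,l) s_{k;l}(c) cos(π(k−2l)/4)`. -/
noncomputable def BkRS (c : ℕ → ℝ) (k : ℕ) : ℝ :=
  ∑ l ∈ Finset.Icc 1 (k - 1),
    ((k - 1).choose l : ℝ) * sklRS c k l * Real.cos (π * ((k : ℝ) - 2 * l) / 4)

open Polynomial in
/-- The minimal polynomial over `ℚ` of a positive real radical is a binomial. -/
lemma minpoly_eq_X_pow_sub_C_of_pow_eq {t : ℝ} (ht : 0 < t) {n : ℕ} (hn : n ≠ 0) {a : ℚ}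
    (h : t ^ n = a) : ∃ b : ℚ, minpoly ℚ t = X ^ (minpoly ℚ t).natDegree - C b := by
  have hroot : aeval t (X ^ n - C a : ℚ[X]) = 0 := by simp [h]
  have hint : IsIntegral ℚ t := ⟨X ^ n - C a, monic_X_pow_sub_C a hn, by simpa using hroot⟩
  have hmonic := minpoly.monic hint
  have hdvd : minpoly ℚ t ∣ X ^ n - C a := minpoly.dvd ℚ t hroot
  have hsplit := IsAlgClosed.splits ((minpoly ℚ t).map (algebraMap ℚ ℂ))
  have hnorm : ∀ z ∈ ((minpoly ℚ t).map (algebraMap ℚ ℂ)).roots, ‖z‖ = t := by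
    intro z hz
    have hz0 : aeval z (minpoly ℚ t) = 0 := by
      have := isRoot_of_mem_roots hz
      rwa [IsRoot.def, eval_map_algebraMap] at this
    obtain ⟨p, hp⟩ := hdvd
    have hza : z ^ n = (a : ℂ) := by
      have : aeval z (X ^ n - C a : ℚ[X]) = 0 := by rw [hp, map_mul, hz0, zero_mul]
      simpa [sub_eq_zero] using this
    have hzn : ‖z‖ ^ n = t ^ n := by
      have ha : (0 : ℝ) < a := h ▸ pow_pos ht n
      rw [← norm_pow, hza, h]
      simpa using ha.le
    exact (pow_left_inj₀ (norm_nonneg z) ht.le hn).1 hzn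
  have hprod : ‖((minpoly ℚ t).map (algebraMap ℚ ℂ)).roots.prod‖
      = t ^ (minpoly ℚ t).natDegree := by
    have h1 : ‖((minpoly ℚ t).map (algebraMap ℚ ℂ)).roots.prod‖
        = (((minpoly ℚ t).map (algebraMap ℚ ℂ)).roots.map (‖·‖)).prod :=
      map_multiset_prod (normHom : ℂ →*₀ ℝ) _
    rw [h1, Multiset.map_congr rfl hnorm, Multiset.map_const', Multiset.prod_replicate,
      ← hsplit.natDegree_eq_card_roots, natDegree_map]
  have hcoeff := hsplit.coeff_zero_eq_prod_roots_of_monic (hmonic.map _)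
  have habs : ((|(minpoly ℚ t).coeff 0| : ℚ) : ℝ) = t ^ (minpoly ℚ t).natDegree := by
    have := congrArg norm hcoeff
    rw [norm_mul, hprod, norm_pow, norm_neg, norm_one, one_pow, one_mul, coeff_map] at this
    rw [← this]
    simp
  have hd : (minpoly ℚ t).natDegree ≠ 0 := (minpoly.natDegree_pos hint).ne'
  refine ⟨|(minpoly ℚ t).coeff 0|, ?_⟩
  refine (eq_of_monic_of_dvd_of_natDegree_le hmonic (monic_X_pow_sub_C _ hd) ?_ ?_).symm
  · refine minpoly.dvd ℚ t ?_
    simp [← habs]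
  · rw [natDegree_X_pow_sub_C]

instance isIntegral_algebraicClosure_rat_real : Algebra.IsIntegral ℚ (algebraicClosure ℚ ℝ) :=
  Algebra.isAlgebraic_iff_isIntegral.1 (algebraicClosure.isAlgebraic ℚ ℝ)

/-- A positive real radical that is irrational has trace zero over `ℚ`. -/
lemma normalizedTrace_eq_zero_of_pow_eq {t : algebraicClosure ℚ ℝ} (ht : 0 < (t : ℝ)) {n : ℕ}
    (hn : n ≠ 0) {a : ℚ} (h : (t : ℝ) ^ n = a) (hirr : ∀ r : ℚ, (t : ℝ) ≠ r) :
    Algebra.normalizedTrace ℚ (algebraicClosure ℚ ℝ) t = 0 := by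
  obtain ⟨b, hb⟩ := minpoly_eq_X_pow_sub_C_of_pow_eq ht hn h
  have hint : IsIntegral ℚ (t : ℝ) := (Algebra.IsIntegral.isIntegral t).map
    (algebraicClosure ℚ ℝ).val
  have hd : 2 ≤ (minpoly ℚ (t : ℝ)).natDegree := by
    rw [minpoly.two_le_natDegree_iff hint]
    rintro ⟨r, hr⟩
    exact hirr r (by simpa using hr.symm)
  have hmin : minpoly ℚ (t : ℝ) = minpoly ℚ t :=
    minpoly.algHom_eq (algebraMap (algebraicClosure ℚ ℝ) ℝ).toRatAlgHom Subtype.val_injective t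
  rw [Algebra.normalizedTrace_minpoly, ← hmin]
  generalize (minpoly ℚ (t : ℝ)).natDegree = d at *
  have : (minpoly ℚ (t : ℝ)).nextCoeff = 0 := by
    rw [hb, Polynomial.nextCoeff_of_natDegree_pos (by rw [Polynomial.natDegree_X_pow_sub_C]; omega),
      Polynomial.natDegree_X_pow_sub_C]
    rw [Polynomial.coeff_sub, Polynomial.coeff_X_pow, Polynomial.coeff_C, if_neg (by omega),
      if_neg (by omega), sub_zero]
  simp [this]

/-- In a vanishing sum of signed positive radicals, every term is a rational multiple of another. -/
lemma exists_ne_ratio_rat_of_sum_eq_zero {ι : Type*} [Fintype ι] {n : ℕ} (hn : n ≠ 0)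
    (x : ι → ℝ) (hx : ∀ j, 0 < x j) (hpow : ∀ j, ∃ a : ℚ, x j ^ n = a) (r : ι → ℚ)
    (hsum : ∑ j, (r j : ℝ) * x j = 0) (i : ι) (hi : r i ≠ 0) :
    ∃ j, j ≠ i ∧ ∃ p : ℚ, x j / x i = p := by
  by_contra! hcon
  have hratio : ∀ j, ∃ a : ℚ, (x j / x i) ^ n = a := by
    intro j
    obtain ⟨a, ha⟩ := hpow j
    obtain ⟨b, hb⟩ := hpow i
    exact ⟨a / b, by rw [div_pow, ha, hb]; push_cast; rfl⟩
  have hint : ∀ j, x j / x i ∈ algebraicClosure ℚ ℝ := by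
    intro j
    obtain ⟨a, ha⟩ := hratio j
    rw [mem_algebraicClosure_iff]
    refine (IsIntegral.of_pow (Nat.pos_of_ne_zero hn) ?_).isAlgebraic
    rw [ha]
    exact isIntegral_algebraMap (R := ℚ) (A := ℝ) (x := a)
  let t : ι → algebraicClosure ℚ ℝ := fun j => ⟨x j / x i, hint j⟩
  have hti : t i = 1 := Subtype.ext (div_self (hx i).ne')
  have hzero : ∑ j, r j • t j = 0 := by
    apply Subtype.ext
    have : ∑ j, (r j : ℝ) * (x j / x i) = 0 := by
      simp_rw [← mul_div_assoc, ← Finset.sum_div, hsum, zero_div]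
    simpa [t, Algebra.smul_def] using this
  have htr := congrArg (Algebra.normalizedTrace ℚ (algebraicClosure ℚ ℝ)) hzero
  rw [map_sum, map_zero, Finset.sum_eq_single i] at htr
  · rw [map_smul, hti, ← map_one (algebraMap ℚ (algebraicClosure ℚ ℝ)),
      Algebra.normalizedTrace_algebraMap_apply_eq_self] at htr
    simp [hi] at htr
  · intro j _ hj
    obtain ⟨a, ha⟩ := hratio j
    rw [map_smul, normalizedTrace_eq_zero_of_pow_eq (t := t j) (div_pos (hx j) (hx i)) hn ha
      (hcon j hj), smul_zero]
  · simp

/-- The least positive integer which equals `n` up to a positive rational `e`-th power. -/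
noncomputable def powerFreePart (e n : ℕ) : ℕ :=
  sInf {w | 0 < w ∧ ∃ a b : ℕ, 0 < a ∧ 0 < b ∧ n * b ^ e = w * a ^ e}

lemma powerFreePart_eq_of_mul_pow_eq {e n n' a b : ℕ} (ha : 0 < a) (hb : 0 < b)
    (h : n * b ^ e = n' * a ^ e) : powerFreePart e n = powerFreePart e n' := by
  have key : ∀ {n n' a b : ℕ}, 0 < a → 0 < b → n * b ^ e = n' * a ^ e →
      {w | 0 < w ∧ ∃ a b : ℕ, 0 < a ∧ 0 < b ∧ n * b ^ e = w * a ^ e} ⊆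
      {w | 0 < w ∧ ∃ a b : ℕ, 0 < a ∧ 0 < b ∧ n' * b ^ e = w * a ^ e} := by
    rintro n n' a b ha hb h w ⟨hw, a', b', ha', hb', hw'⟩
    refine ⟨hw, b * a', a * b', by positivity, by positivity, ?_⟩
    rw [mul_pow, mul_pow]
    calc n' * (a ^ e * b' ^ e) = (n * b' ^ e) * b ^ e := by rw [← mul_assoc, ← h]; ring
      _ = w * (b ^ e * a' ^ e) := by rw [hw']; ring
  exact congrArg sInf (Set.Subset.antisymm (key ha hb h) (key hb ha h.symm))

lemma powerFreePart_spec {e n : ℕ} (hn : 0 < n) :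
    0 < powerFreePart e n ∧ ∃ m, 0 < m ∧ n = powerFreePart e n * m ^ e := by
  have hne : {w | 0 < w ∧ ∃ a b : ℕ, 0 < a ∧ 0 < b ∧ n * b ^ e = w * a ^ e}.Nonempty :=
    ⟨n, hn, 1, 1, one_pos, one_pos, rfl⟩
  obtain ⟨hq, a, b, ha, hb, hab⟩ : powerFreePart e n ∈ _ := Nat.sInf_mem hne
  refine ⟨hq, ?_⟩
  obtain ⟨g, a, b, hg, hcop, rfl, rfl⟩ := Nat.exists_coprime' (Nat.gcd_pos_of_pos_left b ha)
  have ha : 0 < a := Nat.pos_of_mul_pos_right ha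
  have hb : 0 < b := Nat.pos_of_mul_pos_right hb
  have hab : n * b ^ e = powerFreePart e n * a ^ e := by
    have hg' : 0 < g ^ e := pow_pos hg e
    rw [mul_pow, mul_pow, ← mul_assoc, ← mul_assoc] at hab
    exact Nat.eq_of_mul_eq_mul_right hg' hab
  obtain ⟨w, hw⟩ : b ^ e ∣ powerFreePart e n :=
    (hcop.symm.pow e e).dvd_of_dvd_mul_right (hab ▸ Dvd.intro_left n rfl)
  have hnw : n = w * a ^ e := by
    rw [hw] at hab
    exact Nat.eq_of_mul_eq_mul_right (pow_pos hb e) (by rw [hab]; ring)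
  have hwpos : 0 < w := Nat.pos_of_ne_zero (by rintro rfl; simp at hnw; omega)
  have hle : powerFreePart e n ≤ w :=
    Nat.sInf_le ⟨hwpos, a, 1, ha, one_pos, by rw [one_pow, mul_one, hnw]⟩
  have hwle : w ≤ powerFreePart e n := by
    rw [hw]
    exact Nat.le_mul_of_pos_left w (pow_pos hb e)
  exact ⟨a, ha, by rw [le_antisymm hle hwle]; exact hnw⟩

/-- The `e`-th root of the quotient of `n` by its `e`-th power free part. -/
noncomputable def powerPart (e n : ℕ) : ℕ :=
  if h : 0 < n then (powerFreePart_spec (e := e) h).2.choose else 0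

lemma powerPart_spec {e n : ℕ} (hn : 0 < n) :
    0 < powerPart e n ∧ n = powerFreePart e n * powerPart e n ^ e := by
  rw [powerPart, dif_pos hn]
  exact (powerFreePart_spec hn).2.choose_spec

lemma summable_prod_apply {ι κ : Type*} [Fintype ι] {f : κ → ℝ} (hf0 : 0 ≤ f)
    (hf : Summable f) : Summable fun n : ι → κ => ∏ j, f (n j) := by
  refine summable_of_sum_le (c := ∏ _j : ι, ∑' v, f v)
    (fun n => Finset.prod_nonneg fun j _ => hf0 _) fun u => ?_
  calc ∑ n ∈ u, ∏ j, f (n j)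
      ≤ ∑ n ∈ Fintype.piFinset fun j : ι => u.image fun n => n j, ∏ j, f (n j) := by
        refine Finset.sum_le_sum_of_subset_of_nonneg (fun n hn => ?_)
          fun n _ _ => Finset.prod_nonneg fun j _ => hf0 _
        rw [Fintype.mem_piFinset]
        exact fun j => Finset.mem_image_of_mem _ hn
    _ = ∏ j : ι, ∑ v ∈ u.image fun n => n j, f v := by
        rw [Finset.prod_univ_sum]
    _ ≤ ∏ _j : ι, ∑' v, f v := by
        refine Finset.prod_le_prod (fun j _ => Finset.sum_nonneg fun v _ => hf0 v) fun j _ => ?_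
        exact hf.sum_le_tsum _ fun v _ => hf0 v

/-- Tuples all of whose entries are repeated contribute a convergent sum as soon as the squares
of the weights are summable. -/
lemma summable_prod_of_forall_repeated {ι κ : Type*} [Fintype ι] {f : κ → ℝ}
    (hf0 : 0 ≤ f) (hf1 : ∀ v, f v ≤ 1) (hf : Summable fun v => f v ^ 2) :
    Summable fun q : {q : ι → κ // ∀ j, ∃ j', j' ≠ j ∧ q j' = q j} => ∏ j, f (q.1 j) := by
  let H : (ι → ι) → (ι → κ) → ℝ := fun g =>
    {q : ι → κ | q ∘ g = q}.indicator fun q => ∏ v ∈ univ.image g, f (q v) ^ 2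
  have hH0 : ∀ g q, 0 ≤ H g q := fun g q =>
    Set.indicator_nonneg (fun q _ => Finset.prod_nonneg fun v _ => sq_nonneg _) q
  have hH : ∀ g, Summable (H g) := by
    intro g
    rw [← summable_subtype_iff_indicator]
    let r : {q : ι → κ | q ∘ g = q} → (univ.image g → κ) := fun q v => q.1 v
    have hr : Function.Injective r := by
      intro q q' h
      apply Subtype.ext
      funext j
      have h1 := congrFun h ⟨g j, Finset.mem_image_of_mem g (mem_univ j)⟩
      have h2 := congrFun q.2 j
      have h3 := congrFun q'.2 j
      simp only [r, Function.comp_apply] at h1 h2 h3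
      rw [← h2, ← h3, h1]
    have hpi := summable_prod_apply (ι := univ.image g) (fun v => sq_nonneg (f v)) hf
    refine (hpi.comp_injective hr).congr fun q => ?_
    exact Finset.prod_coe_sort (univ.image g) fun v => f (q.1 v) ^ 2
  have hsum : Summable fun q : ι → κ => ∑ g, H g q := summable_sum fun g _ => hH g
  refine Summable.of_nonneg_of_le (fun q => Finset.prod_nonneg fun j _ => hf0 _) ?_
    (hsum.comp_injective Subtype.val_injective)
  rintro ⟨q, hq⟩
  have hrep : ∀ v : Set.range q, ∃ j, q j = v := fun v => v.2
  choose rep hrep using hrep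
  let g : ι → ι := fun j => rep ⟨q j, j, rfl⟩
  have hqg : ∀ j, q (g j) = q j := fun j => hrep _
  have hgg : ∀ i j, q i = q j → g i = g j := fun i j h => by simp only [g, h]
  refine le_trans ?_ (Finset.single_le_sum (f := fun g => H g q) (fun g _ => hH0 g q) (mem_univ g))
  simp only [H]
  rw [Set.indicator_of_mem (show q ∈ {q : ι → κ | q ∘ g = q} from funext hqg),
    ← Finset.prod_fiberwise_of_maps_to (t := univ.image g)
      (fun j _ => Finset.mem_image_of_mem g (mem_univ j))]
  refine Finset.prod_le_prod (fun v _ => Finset.prod_nonneg fun j _ => hf0 _) fun v hv => ?_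
  obtain ⟨j, -, rfl⟩ := Finset.mem_image.1 hv
  have hconst : ∀ i ∈ univ.filter (fun i => g i = g j), f (q i) = f (q (g j)) := by
    intro i hi
    rw [← (Finset.mem_filter.1 hi).2, hqg]
  rw [Finset.prod_congr rfl hconst, Finset.prod_const]
  refine pow_le_pow_of_le_one (hf0 _) (hf1 _) ?_
  obtain ⟨j', hj', hqj'⟩ := hq j
  exact Finset.one_lt_card.2 ⟨j, by simp, j', by simpa using hgg j' j hqj', hj'.symm⟩

/-- Tuples in which every entry shares its `e`-th power free part with another entry. -/
lemma summable_prod_of_powerFreePart_repeated {ι : Type*} [Fintype ι] {e : ℕ} (he : 2 ≤ e) {s : ℝ}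
    (hs : 1 / 2 < s) :
    Summable fun n : {n : ι → ℕ // (∀ j, 0 < n j) ∧
        ∀ j, ∃ j', j' ≠ j ∧ powerFreePart e (n j') = powerFreePart e (n j)} =>
      ∏ j, (n.1 j : ℝ) ^ (-s) := by
  have h1 := summable_prod_of_forall_repeated (ι := ι) (f := fun v : ℕ => (v : ℝ) ^ (-s))
    (fun v => by positivity) (fun v => ?_) ?_
  · have h2 := summable_prod_apply (ι := ι) (f := fun v : ℕ => (v : ℝ) ^ (-(e * s)))
      (fun v => by positivity) (Real.summable_nat_rpow.2 ?_)
    · have h3 := h1.mul_of_nonneg h2 (fun q => Finset.prod_nonneg fun j _ => by positivity)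
        (fun q => Finset.prod_nonneg fun j _ => by positivity)
      let r : {n : ι → ℕ // (∀ j, 0 < n j) ∧
          ∀ j, ∃ j', j' ≠ j ∧ powerFreePart e (n j') = powerFreePart e (n j)} →
          {q : ι → ℕ // ∀ j, ∃ j', j' ≠ j ∧ q j' = q j} × (ι → ℕ) :=
        fun n => (⟨fun j => powerFreePart e (n.1 j), n.2.2⟩, fun j => powerPart e (n.1 j))
      have hr : Function.Injective r := by
        intro n n' h
        apply Subtype.ext
        funext j
        have hq := congrFun (congrArg Subtype.val (congrArg Prod.fst h)) j
        have hm := congrFun (congrArg Prod.snd h) j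
        simp only [r] at hq hm
        rw [(powerPart_spec (n.2.1 j)).2, hq, hm, ← (powerPart_spec (n'.2.1 j)).2]
      refine (h3.comp_injective hr).congr fun n => ?_
      simp only [Function.comp_apply, r]
      rw [← Finset.prod_mul_distrib]
      refine Finset.prod_congr rfl fun j _ => ?_
      conv_rhs => rw [(powerPart_spec (e := e) (n.2.1 j)).2]
      push_cast
      rw [Real.mul_rpow (by positivity) (by positivity), ← Real.rpow_natCast, ← Real.rpow_mul
        (by positivity), mul_neg]
    · have : (2 : ℝ) ≤ e := by exact_mod_cast he
      nlinarith
  · rcases Nat.eq_zero_or_pos v with rfl | hv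
    · rw [Nat.cast_zero, Real.zero_rpow (by linarith)]
      exact zero_le_one
    · exact Real.rpow_le_one_of_one_le_of_nonpos (by exact_mod_cast hv) (by linarith)
  · have : Summable fun v : ℕ => (v : ℝ) ^ (-(2 * s)) := Real.summable_nat_rpow.2 (by linarith)
    refine this.congr fun v => ?_
    rw [← Real.rpow_natCast, ← Real.rpow_mul (by positivity)]
    congr 1
    push_cast
    ring

lemma powerFreePart_eq_of_rpow_div_eq {n n' : ℕ} (hn : 0 < n) (hn' : 0 < n') {p : ℚ}
    (h : (n : ℝ) ^ ((1 : ℝ) / 4) / (n' : ℝ) ^ ((1 : ℝ) / 4) = p) :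
    powerFreePart 4 n = powerFreePart 4 n' := by
  have hnR : (0 : ℝ) < n := by exact_mod_cast hn
  have hnR' : (0 : ℝ) < n' := by exact_mod_cast hn'
  have hp : (0 : ℚ) < p := by
    have : (0 : ℝ) < p := h ▸ by positivity
    exact_mod_cast this
  obtain ⟨a, ha⟩ : ∃ a : ℕ, (a : ℤ) = p.num :=
    ⟨p.num.toNat, Int.toNat_of_nonneg (Rat.num_pos.2 hp).le⟩
  have ha0 : 0 < a := by have := Rat.num_pos.2 hp; omega
  have hpow : ∀ m : ℕ, ((m : ℝ) ^ ((1 : ℝ) / 4)) ^ 4 = m := fun m => by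
    rw [← Real.rpow_natCast, ← Real.rpow_mul (by positivity)]
    norm_num
  have hq : (n : ℝ) / n' = (p : ℝ) ^ 4 := by rw [← h, div_pow, hpow, hpow]
  have hpe : (p : ℝ) = a / p.den := by
    conv_lhs => rw [← Rat.num_div_den p, ← ha]
    push_cast
    rfl
  have hden : (0 : ℝ) < p.den := by exact_mod_cast p.pos
  refine powerFreePart_eq_of_mul_pow_eq ha0 p.pos ?_
  rw [hpe, div_pow, div_eq_div_iff hnR'.ne' (by positivity)] at hq
  have : (n : ℝ) * (p.den : ℝ) ^ 4 = n' * (a : ℝ) ^ 4 := by rw [hq]; ring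
  exact_mod_cast this

lemma exists_powerFreePart_eq_of_alphaRS_eq_zero {k : ℕ} {n : Fin k → ℕ} {i : Fin k → Bool}
    (hn : ∀ j, 0 < n j) (h : alphaRS n i = 0) (j : Fin k) :
    ∃ j', j' ≠ j ∧ powerFreePart 4 (n j') = powerFreePart 4 (n j) := by
  have hx : ∀ j, 0 < (n j : ℝ) ^ ((1 : ℝ) / 4) := fun j =>
    Real.rpow_pos_of_pos (by exact_mod_cast hn j) _
  obtain ⟨j', hj', p, hp⟩ := exists_ne_ratio_rat_of_sum_eq_zero (n := 4) (by norm_num) _ hx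
    (fun j => ⟨n j, by
      rw [← Real.rpow_natCast, ← Real.rpow_mul (by positivity)]
      norm_num⟩)
    (fun j => if i j then -1 else 1)
    (by
      rw [← h, alphaRS]
      refine Finset.sum_congr rfl fun j _ => ?_
      split_ifs <;> norm_num) j (by split_ifs <;> norm_num)
  exact ⟨j', hj', powerFreePart_eq_of_rpow_div_eq (hn j') (hn j) hp⟩

/-- In a solution of `alphaRS n i = 0` no single entry dominates the product of the others. -/
lemma sqrt_le_prod_of_alphaRS_eq_zero {k : ℕ} {n : Fin k → ℕ} {i : Fin k → Bool}
    (hn : ∀ j, 0 < n j) (h : alphaRS n i = 0) (a : Fin k) :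
    (n a : ℝ) ^ ((1 : ℝ) / 2) ≤ k * ∏ j, (n j : ℝ) ^ ((1 : ℝ) / 4) := by
  set x : Fin k → ℝ := fun j => (n j : ℝ) ^ ((1 : ℝ) / 4) with hxdef
  have hx1 : ∀ j, 1 ≤ x j := fun j => Real.one_le_rpow (by exact_mod_cast hn j) (by norm_num)
  have hx0 : ∀ j, 0 ≤ x j := fun j => zero_le_one.trans (hx1 j)
  have hsq : (n a : ℝ) ^ ((1 : ℝ) / 2) = x a * x a := by
    rw [hxdef, ← Real.rpow_add (by exact_mod_cast hn a)]
    norm_num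
  have hle : x a ≤ ∑ j ∈ univ.erase a, x j := by
    rw [alphaRS, ← Finset.add_sum_erase _ _ (mem_univ a)] at h
    have h1 : |(if i a then (-1 : ℝ) else 1) * x a| = x a := by
      split_ifs <;> simp [abs_of_nonneg (hx0 a)]
    rw [← h1, eq_neg_of_add_eq_zero_left h, abs_neg]
    refine (Finset.abs_sum_le_sum_abs _ _).trans (Finset.sum_le_sum fun j _ => ?_)
    have h2 : |(if i j then (-1 : ℝ) else 1) * x j| = x j := by
      split_ifs <;> simp [abs_of_nonneg (hx0 j)]
    exact h2.le
  have hprod : ∀ j ∈ univ.erase a, x j ≤ ∏ j ∈ univ.erase a, x j := fun j hj => by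
    rw [← Finset.mul_prod_erase _ _ hj]
    exact le_mul_of_one_le_right (hx0 j) (Finset.one_le_prod fun j _ => hx1 j)
  have hP : 0 ≤ ∏ j ∈ univ.erase a, x j := Finset.prod_nonneg fun j _ => hx0 j
  have hsum : ∑ j ∈ univ.erase a, x j ≤ k * ∏ j ∈ univ.erase a, x j := by
    refine (Finset.sum_le_card_nsmul _ _ _ hprod).trans ?_
    rw [nsmul_eq_mul]
    refine mul_le_mul_of_nonneg_right ?_ hP
    exact_mod_cast (Finset.card_le_univ _).trans_eq (Fintype.card_fin k)
  rw [hsq, ← Finset.mul_prod_erase _ _ (mem_univ a)]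
  calc x a * x a ≤ x a * (k * ∏ j ∈ univ.erase a, x j) :=
        mul_le_mul_of_nonneg_left (hle.trans hsum) (hx0 a)
    _ = _ := by ring

lemma exists_weight_mul_rpow_le {c : ℕ → ℝ} (hc0 : ∀ n, 0 ≤ c n)
    (hc : ∀ ε : ℝ, 0 < ε → ∃ K : ℝ, 0 < K ∧ ∀ n : ℕ, 1 ≤ n → c n ≤ K * (n : ℝ) ^ ε)
    (k : ℕ) {ε : ℝ} (hε : 0 < ε) (hε1 : ε ≤ 1 / 2) :
    ∃ K : ℝ, 0 ≤ K ∧ ∀ (i : Fin k → Bool) (n : Fin k → ℕ), (∀ j, 0 < n j) → alphaRS n i = 0 →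
      ∀ a, (∏ j, c (n j)) / (∏ j, (n j : ℝ)) ^ ((7 : ℝ) / 8) * (n a : ℝ) ^ (3 / 4 - ε) ≤
        K * ∏ j, (n j : ℝ) ^ (-(1 / 2 + ε / 4)) := by
  obtain ⟨K, hK, hcK⟩ := hc (ε / 4) (by linarith)
  refine ⟨K ^ k * (k : ℝ) ^ (3 / 2 - 2 * ε), by positivity, fun i n hn h a => ?_⟩
  have hnR : ∀ j, (0 : ℝ) < n j := fun j => by exact_mod_cast hn j
  have h1 : ∏ j, c (n j) ≤ K ^ k * ∏ j, (n j : ℝ) ^ (ε / 4) := by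
    refine (Finset.prod_le_prod (fun j _ => hc0 _) fun j _ => hcK (n j) (hn j)).trans_eq ?_
    rw [Finset.prod_mul_distrib, Finset.prod_const, Finset.card_univ, Fintype.card_fin]
  have h2 : (n a : ℝ) ^ (3 / 4 - ε) ≤
      (k : ℝ) ^ (3 / 2 - 2 * ε) * ∏ j, (n j : ℝ) ^ (3 / 8 - ε / 2) := by
    have h3 := Real.rpow_le_rpow (z := 3 / 2 - 2 * ε) (by positivity)
      (sqrt_le_prod_of_alphaRS_eq_zero hn h a) (by linarith)
    rw [← Real.rpow_mul (by positivity), Real.mul_rpow (by positivity)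
      (Finset.prod_nonneg fun j _ => by positivity),
      ← Real.finsetProd_rpow _ _ fun j _ => by positivity] at h3
    convert h3 using 2
    · ring_nf
    · refine Finset.prod_congr rfl fun j _ => ?_
      rw [← Real.rpow_mul (by positivity)]
      ring_nf
  calc (∏ j, c (n j)) / (∏ j, (n j : ℝ)) ^ ((7 : ℝ) / 8) * (n a : ℝ) ^ (3 / 4 - ε)
      ≤ (K ^ k * ∏ j, (n j : ℝ) ^ (ε / 4)) / (∏ j, (n j : ℝ)) ^ ((7 : ℝ) / 8) *
        ((k : ℝ) ^ (3 / 2 - 2 * ε) * ∏ j, (n j : ℝ) ^ (3 / 8 - ε / 2)) := by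
        gcongr
    _ = K ^ k * (k : ℝ) ^ (3 / 2 - 2 * ε) * ∏ j, ((n j : ℝ) ^ (ε / 4) *
          (n j : ℝ) ^ (-(7 / 8 : ℝ)) * (n j : ℝ) ^ (3 / 8 - ε / 2)) := by
        rw [div_eq_mul_inv, ← Real.rpow_neg (Finset.prod_nonneg fun j _ => by positivity),
          ← Real.finsetProd_rpow _ _ fun j _ => by positivity, Finset.prod_mul_distrib,
          Finset.prod_mul_distrib]
        ring
    _ = _ := by
        congr 1
        refine Finset.prod_congr rfl fun j _ => ?_
        rw [← Real.rpow_add (hnR j), ← Real.rpow_add (hnR j)]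
        ring_nf

/-- The set of positive tuples annihilated by `alphaRS · i`. -/
def alphaZeroSet {k : ℕ} (i : Fin k → Bool) : Set (Fin k → ℕ) :=
  {n | (∀ j, 0 < n j) ∧ alphaRS n i = 0}

/-- Truncating the sum over the solutions of `alphaRS n i = 0` costs `O(y ^ (-3/4 + ε))`. -/
lemma exists_abs_box_sub_tsum_le {c : ℕ → ℝ} (hc0 : ∀ n, 0 ≤ c n)
    (hc : ∀ ε : ℝ, 0 < ε → ∃ K : ℝ, 0 < K ∧ ∀ n : ℕ, 1 ≤ n → c n ≤ K * (n : ℝ) ^ ε)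
    {k : ℕ} (hk : 0 < k) {ε : ℝ} (hε : 0 < ε) (hε1 : ε ≤ 1 / 2) :
    ∃ C : ℝ, 0 ≤ C ∧ ∀ (i : Fin k → Bool) (y : ℝ), 2 ≤ y →
      |∑ n ∈ Fintype.piFinset (fun _ : Fin k => Finset.Icc 1 ⌊y⌋₊),
          (if alphaRS n i = 0 then
            (∏ j, c (n j)) / (∏ j, (n j : ℝ)) ^ ((7 : ℝ) / 8) else 0) -
        ∑' n, (alphaZeroSet i).indicator
          (fun n => (∏ j, c (n j)) / (∏ j, (n j : ℝ)) ^ ((7 : ℝ) / 8)) n| ≤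
      C * y ^ (-(3 : ℝ) / 4 + ε) := by
  obtain ⟨K, hK, hKw⟩ := exists_weight_mul_rpow_le hc0 hc k hε hε1
  set R : Set (Fin k → ℕ) := {n | (∀ j, 0 < n j) ∧
    ∀ j, ∃ j', j' ≠ j ∧ powerFreePart 4 (n j') = powerFreePart 4 (n j)} with hR
  set g : (Fin k → ℕ) → ℝ :=
    R.indicator fun n => ∏ j, (n j : ℝ) ^ (-(1 / 2 + ε / 4)) with hg
  have hgsum : Summable g := summable_subtype_iff_indicator.1
    (summable_prod_of_powerFreePart_repeated (ι := Fin k) (e := 4) (by norm_num) (by linarith))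
  have hg0 : ∀ n, 0 ≤ g n := fun n =>
    Set.indicator_nonneg (fun n _ => Finset.prod_nonneg fun j _ => by positivity) n
  refine ⟨K * ∑' n, g n, mul_nonneg hK (tsum_nonneg hg0), fun i y hy => ?_⟩
  set F : (Fin k → ℕ) → ℝ := fun n => (∏ j, c (n j)) / (∏ j, (n j : ℝ)) ^ ((7 : ℝ) / 8) with hF
  have hF0 : ∀ n, 0 ≤ F n := fun n =>
    div_nonneg (Finset.prod_nonneg fun j _ => hc0 _) (by positivity)
  set f := (alphaZeroSet i).indicator F with hf
  have hf0 : ∀ n, 0 ≤ f n := fun n => Set.indicator_nonneg (fun n _ => hF0 n) n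
  have hfg : ∀ n a, f n * (n a : ℝ) ^ (3 / 4 - ε) ≤ K * g n := by
    intro n a
    by_cases hn : n ∈ alphaZeroSet i
    · have hnR : n ∈ R := ⟨hn.1, exists_powerFreePart_eq_of_alphaRS_eq_zero hn.1 hn.2⟩
      rw [hf, hg, Set.indicator_of_mem hn, Set.indicator_of_mem hnR]
      exact hKw i n hn.1 hn.2 a
    · rw [hf, Set.indicator_of_notMem hn, zero_mul]
      exact mul_nonneg hK (hg0 n)
  have hfsum : Summable f := by
    refine Summable.of_nonneg_of_le hf0 (fun n => ?_) (hgsum.mul_left K)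
    by_cases hn : n ∈ alphaZeroSet i
    · refine le_trans (le_mul_of_one_le_right (hf0 n) ?_) (hfg n ⟨0, hk⟩)
      exact Real.one_le_rpow (by exact_mod_cast hn.1 _) (by linarith)
    · rw [hf, Set.indicator_of_notMem hn]
      exact mul_nonneg hK (hg0 n)
  set B := Fintype.piFinset (fun _ : Fin k => Finset.Icc 1 ⌊y⌋₊) with hB
  have hbox : ∑ n ∈ B, (if alphaRS n i = 0 then F n else 0) = ∑ n ∈ B, f n := by
    refine Finset.sum_congr rfl fun n hn => ?_
    have hpos : ∀ j, 0 < n j := fun j =>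
      (Finset.mem_Icc.1 (Fintype.mem_piFinset.1 hn j)).1
    by_cases h : alphaRS n i = 0
    · rw [if_pos h, hf, Set.indicator_of_mem (show n ∈ alphaZeroSet i from ⟨hpos, h⟩)]
    · rw [if_neg h, hf, Set.indicator_of_notMem (fun hn => h hn.2)]
  have hy0 : 0 < y := by linarith
  have htail : ∀ n ∉ B, f n ≤ y ^ (-(3 : ℝ) / 4 + ε) * (K * g n) := by
    intro n hn
    by_cases hz : n ∈ alphaZeroSet i
    · obtain ⟨a, ha⟩ : ∃ a, n a ∉ Finset.Icc 1 ⌊y⌋₊ := by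
        by_contra! hcon
        exact hn (Fintype.mem_piFinset.2 hcon)
      have hya : y ≤ n a := by
        have h1 := hz.1 a
        rw [Finset.mem_Icc, not_and] at ha
        exact (Nat.lt_of_floor_lt (not_le.1 (ha h1))).le
      have h2 : y ^ (3 / 4 - ε) * f n ≤ K * g n := by
        refine le_trans ?_ (hfg n a)
        rw [mul_comm]
        exact mul_le_mul_of_nonneg_left
          (Real.rpow_le_rpow hy0.le hya (by linarith)) (hf0 n)
      calc f n = y ^ (-(3 : ℝ) / 4 + ε) * (y ^ (3 / 4 - ε) * f n) := by
            rw [← mul_assoc, ← Real.rpow_add hy0]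
            ring_nf
            simp
        _ ≤ _ := mul_le_mul_of_nonneg_left h2 (by positivity)
    · rw [hf, Set.indicator_of_notMem hz]
      exact mul_nonneg (by positivity) (mul_nonneg hK (hg0 n))
  have hmaj : Summable fun n => y ^ (-(3 : ℝ) / 4 + ε) * (K * g n) :=
    (hgsum.mul_left K).mul_left _
  rw [hbox, ← hfsum.sum_add_tsum_subtype_compl B, sub_add_cancel_left, abs_neg,
    abs_of_nonneg (tsum_nonneg fun n => hf0 _)]
  calc ∑' n : {n // n ∉ B}, f n
      ≤ ∑' n : {n // n ∉ B}, y ^ (-(3 : ℝ) / 4 + ε) * (K * g n) :=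
        (hfsum.subtype _).tsum_le_tsum (fun n => htail n n.2) (hmaj.subtype _)
    _ ≤ ∑' n, y ^ (-(3 : ℝ) / 4 + ε) * (K * g n) :=
        hmaj.tsum_subtype_le _ {n | n ∉ B}
          (fun n => mul_nonneg (by positivity) (mul_nonneg hK (hg0 n)))
    _ = K * (∑' n, g n) * y ^ (-(3 : ℝ) / 4 + ε) := by
        rw [tsum_mul_left, tsum_mul_left]
        ring

lemma alphaRS_eq_sum_sub_sum {k l : ℕ} {i : Fin k → Bool} (e : Equiv.Perm (Fin k))
    (he : ∀ j, i j = true ↔ (e j : ℕ) < l) (n : Fin k → ℕ) :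
    alphaRS (n ∘ e) i =
      ∑ j ∈ univ.filter (fun j : Fin k => l ≤ (j : ℕ)), ((n j : ℝ)) ^ ((1 : ℝ) / 4) -
        ∑ j ∈ univ.filter (fun j : Fin k => (j : ℕ) < l), ((n j : ℝ)) ^ ((1 : ℝ) / 4) := by
  have h1 : alphaRS (n ∘ e) i =
      ∑ j : Fin k, (if (j : ℕ) < l then (-1 : ℝ) else 1) * (n j : ℝ) ^ ((1 : ℝ) / 4) := by
    rw [alphaRS, ← Equiv.sum_comp e fun j : Fin k =>
      (if (j : ℕ) < l then (-1 : ℝ) else 1) * (n j : ℝ) ^ ((1 : ℝ) / 4)]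
    refine Finset.sum_congr rfl fun j _ => ?_
    simp only [he, Function.comp_apply]
  rw [h1, Finset.sum_filter, Finset.sum_filter, ← Finset.sum_sub_distrib]
  refine Finset.sum_congr rfl fun j _ => ?_
  by_cases h : (j : ℕ) < l
  · simp [h, not_le.2 h]
  · simp [h, not_lt.1 h]

lemma exists_perm_lt_iff {k : ℕ} (i : Fin k → Bool) :
    ∃ e : Equiv.Perm (Fin k), ∀ j,
      i j = true ↔ (e j : ℕ) < (univ.filter fun j => i j = true).card := by
  set l := (univ.filter fun j => i j = true).card with hl
  have hlk : l ≤ k := (Finset.card_le_univ _).trans_eq (Fintype.card_fin k)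
  have hcard : Fintype.card {j : Fin k // i j = true} =
      Fintype.card {j : Fin k // (j : ℕ) < l} := by
    rw [Fintype.card_subtype, Fintype.card_subtype, Fin.card_filter_val_lt, min_eq_right hlk]
  let e := Fintype.equivOfCardEq hcard
  refine ⟨e.extendSubtype, fun j => ⟨fun h => e.extendSubtype_mem j h, fun h => ?_⟩⟩
  by_contra hj
  exact e.extendSubtype_not_mem j hj h

lemma tsum_indicator_alphaZeroSet (c : ℕ → ℝ) {k : ℕ} (i : Fin k → Bool) :
    ∑' n, (alphaZeroSet i).indicator
        (fun n => (∏ j, c (n j)) / (∏ j, (n j : ℝ)) ^ ((7 : ℝ) / 8)) n =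
      sklRS c k (univ.filter fun j => i j = true).card := by
  obtain ⟨e, he⟩ := exists_perm_lt_iff i
  set l := (univ.filter fun j => i j = true).card
  rw [← (Equiv.arrowCongr e.symm (Equiv.refl ℕ)).tsum_eq]
  have hskl := tsum_subtype {n : Fin k → ℕ | (∀ j, 0 < n j) ∧
      ∑ j ∈ univ.filter (fun j : Fin k => (j : ℕ) < l), ((n j : ℝ)) ^ ((1 : ℝ) / 4) =
        ∑ j ∈ univ.filter (fun j : Fin k => l ≤ (j : ℕ)), ((n j : ℝ)) ^ ((1 : ℝ) / 4)}
    fun n => (∏ j, c (n j)) / (∏ j, (n j : ℝ)) ^ ((7 : ℝ) / 8)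
  refine Eq.trans ?_ hskl.symm
  refine tsum_congr fun n => ?_
  have hn : (Equiv.arrowCongr e.symm (Equiv.refl ℕ)) n = n ∘ e := rfl
  rw [hn, Set.indicator_apply, Set.indicator_apply]
  have hmem : n ∘ e ∈ alphaZeroSet i ↔ n ∈ {n : Fin k → ℕ | (∀ j, 0 < n j) ∧
      ∑ j ∈ univ.filter (fun j : Fin k => (j : ℕ) < l), ((n j : ℝ)) ^ ((1 : ℝ) / 4) =
        ∑ j ∈ univ.filter (fun j : Fin k => l ≤ (j : ℕ)), ((n j : ℝ)) ^ ((1 : ℝ) / 4)} := by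
    rw [alphaZeroSet, Set.mem_ofPred_eq, Set.mem_ofPred_eq, alphaRS_eq_sum_sub_sum e he,
      sub_eq_zero, eq_comm]
    exact and_congr_left fun _ => e.forall_congr_right (q := fun j => 0 < n j)
  have h1 : ∏ j, c ((n ∘ e) j) = ∏ j, c (n j) := Equiv.prod_comp e fun j => c (n j)
  have h2 : ∏ j, (((n ∘ e) j : ℕ) : ℝ) = ∏ j, (n j : ℝ) := Equiv.prod_comp e fun j => (n j : ℝ)
  simp only [hmem, h1, h2]

lemma betaRS_eq {k : ℕ} (i : Fin k → Bool) :
    betaRS i = (k : ℝ) - 2 * (univ.filter fun j => i j = true).card := by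
  have h : ∀ j, (if i j = true then (-1 : ℝ) else 1) = 1 - 2 * (if i j = true then 1 else 0) := by
    intro j
    split_ifs <;> norm_num
  rw [betaRS, Finset.sum_congr rfl fun j _ => h j, Finset.sum_sub_distrib, ← Finset.mul_sum,
    Finset.sum_boole]
  simp

lemma sklRS_zero (c : ℕ → ℝ) {k : ℕ} (hk : 0 < k) : sklRS c k 0 = 0 := by
  have : IsEmpty {n : Fin k → ℕ // (∀ j, 0 < n j) ∧
      ∑ j ∈ univ.filter (fun j : Fin k => (j : ℕ) < 0), ((n j : ℝ)) ^ ((1 : ℝ) / 4) =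
        ∑ j ∈ univ.filter (fun j : Fin k => 0 ≤ (j : ℕ)), ((n j : ℝ)) ^ ((1 : ℝ) / 4)} := by
    refine ⟨fun n => ?_⟩
    have h := n.2.2
    simp only [not_lt_zero, Finset.filter_false, Finset.sum_empty, zero_le, Finset.filter_true] at h
    refine h.not_lt (Finset.sum_pos (fun j _ => ?_) ⟨⟨0, hk⟩, mem_univ _⟩)
    exact Real.rpow_pos_of_pos (by exact_mod_cast n.2.1 j) _
  exact tsum_empty

lemma card_filter_signs {k : ℕ} (j₀ : Fin k) (l : ℕ) :
    (univ.filter fun i : Fin k → Bool =>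
      i j₀ = false ∧ (univ.filter fun j => i j = true).card = l).card = (k - 1).choose l := by
  have hcard : (univ.erase j₀).card = k - 1 := by
    rw [Finset.card_erase_of_mem (mem_univ _), Finset.card_univ, Fintype.card_fin]
  rw [← hcard, ← Finset.card_powersetCard]
  refine Finset.card_nbij' (fun i => univ.filter fun j => i j = true) (fun s j => decide (j ∈ s))
    (fun i hi => ?_) (fun s hs => ?_) (fun i _ => ?_) (fun s _ => ?_)
  · have hi := (Finset.mem_filter.1 hi).2
    refine Finset.mem_powersetCard.2 ⟨fun j hj => Finset.mem_erase.2 ⟨?_, mem_univ j⟩, hi.2⟩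
    rintro rfl
    simp [hi.1] at hj
  · have hs := Finset.mem_powersetCard.1 hs
    have : j₀ ∉ s := fun h => Finset.notMem_erase j₀ univ (hs.1 h)
    simp [this, hs.2]
  · ext j
    simp
  · ext j
    simp

/-- The complete signed sum regroups, by the number of minus signs, into `BkRS c k`. -/
lemma sum_signs_cos_mul_tsum (c : ℕ → ℝ) {k : ℕ} (j₀ : Fin k) :
    ∑ i ∈ univ.filter (fun i : Fin k → Bool => i j₀ = false),
      Real.cos (π * betaRS i / 4) * ∑' n, (alphaZeroSet i).indicator
        (fun n => (∏ j, c (n j)) / (∏ j, (n j : ℝ)) ^ ((7 : ℝ) / 8)) n = BkRS c k := by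
  have hk : 0 < k := j₀.pos
  have hmaps : ∀ i ∈ univ.filter (fun i : Fin k → Bool => i j₀ = false),
      (univ.filter fun j => i j = true).card ∈ Finset.range k := by
    intro i hi
    have h := Finset.card_lt_card (s := univ.filter fun j => i j = true) (t := univ)
      ((Finset.ssubset_univ_iff).2 fun h => by
        have := h ▸ mem_univ j₀
        simp [(Finset.mem_filter.1 hi).2] at this)
    rw [Finset.card_univ, Fintype.card_fin] at h
    exact Finset.mem_range.2 h
  rw [← Finset.sum_fiberwise_of_maps_to hmaps, Finset.range_eq_Ico,
    Finset.sum_eq_sum_Ico_succ_bot hk]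
  have hterm : ∀ l, ∑ i ∈ univ.filter (fun i : Fin k → Bool => i j₀ = false) with
      (univ.filter fun j => i j = true).card = l,
      Real.cos (π * betaRS i / 4) * ∑' n, (alphaZeroSet i).indicator
        (fun n => (∏ j, c (n j)) / (∏ j, (n j : ℝ)) ^ ((7 : ℝ) / 8)) n =
      ((k - 1).choose l : ℝ) * sklRS c k l * Real.cos (π * ((k : ℝ) - 2 * l) / 4) := by
    intro l
    rw [Finset.sum_congr rfl (g := fun _ => Real.cos (π * ((k : ℝ) - 2 * l) / 4) * sklRS c k l),
      Finset.sum_const, Finset.filter_filter, card_filter_signs, nsmul_eq_mul]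
    · ring
    · intro i hi
      rw [tsum_indicator_alphaZeroSet, betaRS_eq, (Finset.mem_filter.1 hi).2]
  rw [hterm 0, sklRS_zero c hk, BkRS]
  have hIco : Finset.Ico (0 + 1) k = Finset.Icc 1 (k - 1) := by
    ext l
    simp only [Finset.mem_Ico, Finset.mem_Icc]
    omega
  rw [hIco, Finset.sum_congr rfl fun l _ => hterm l]
  ring

lemma integral_rpow_le {T r : ℝ} (hT : 0 < T) (hr : 0 ≤ r) :
    |∫ x in T..(2 * T), x ^ r| ≤ 2 ^ r * T ^ (1 + r) := by
  have h := intervalIntegral.norm_integral_le_of_norm_le_const (a := T) (b := 2 * T)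
    (f := fun x : ℝ => x ^ r) (C := (2 * T) ^ r) fun x hx => by
      rw [Set.uIoc_of_le (by linarith)] at hx
      rw [Real.norm_of_nonneg (Real.rpow_nonneg (hT.trans hx.1).le _)]
      exact Real.rpow_le_rpow (hT.trans hx.1).le hx.2 hr
  rw [Real.norm_eq_abs] at h
  refine h.trans_eq ?_
  rw [show 2 * T - T = T by ring, abs_of_pos hT, Real.mul_rpow zero_le_two hT.le,
    Real.rpow_add hT, Real.rpow_one]
  ring

/-- The truncated signed sum approximates `BkRS c k`, for every `k`. -/
lemma exists_abs_sum_signs_sub_BkRS_le {c : ℕ → ℝ} (hc0 : ∀ n, 0 ≤ c n)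
    (hc : ∀ ε : ℝ, 0 < ε → ∃ K : ℝ, 0 < K ∧ ∀ n : ℕ, 1 ≤ n → c n ≤ K * (n : ℝ) ^ ε)
    {k : ℕ} (j₀ : Fin k) {ε : ℝ} (hε : 0 < ε) :
    ∃ C : ℝ, 0 < C ∧ ∀ y : ℝ, 2 ≤ y →
      |(∑ i ∈ univ.filter (fun i : Fin k → Bool => i j₀ = false),
          Real.cos (π * betaRS i / 4) *
            ∑ n ∈ Fintype.piFinset (fun _ : Fin k => Finset.Icc 1 ⌊y⌋₊),
              (if alphaRS n i = 0 then
                (∏ j, c (n j)) / (∏ j, (n j : ℝ)) ^ ((7 : ℝ) / 8) else 0)) - BkRS c k| ≤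
        C * y ^ (-(3 : ℝ) / 4 + ε) := by
  obtain ⟨C, hC, h⟩ := exists_abs_box_sub_tsum_le hc0 hc j₀.pos (ε := min ε (1 / 2))
    (lt_min hε (by norm_num)) (min_le_right _ _)
  refine ⟨2 ^ k * C + 1, by positivity, fun y hy => ?_⟩
  have hpow : y ^ (-(3 : ℝ) / 4 + min ε (1 / 2)) ≤ y ^ (-(3 : ℝ) / 4 + ε) :=
    Real.rpow_le_rpow_of_exponent_le (by linarith) (by linarith [min_le_left ε (1 / 2)])
  have hy0 : 0 ≤ y ^ (-(3 : ℝ) / 4 + ε) := by positivity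
  rw [← sum_signs_cos_mul_tsum c j₀, ← Finset.sum_sub_distrib]
  calc _ ≤ ∑ i ∈ univ.filter (fun i : Fin k → Bool => i j₀ = false),
        C * y ^ (-(3 : ℝ) / 4 + ε) := by
        refine (Finset.abs_sum_le_sum_abs _ _).trans (Finset.sum_le_sum fun i _ => ?_)
        rw [← mul_sub, abs_mul]
        refine (mul_le_of_le_one_left (abs_nonneg _) (Real.abs_cos_le_one _)).trans ?_
        exact (h i y hy).trans (mul_le_mul_of_nonneg_left hpow hC)
    _ ≤ 2 ^ k * (C * y ^ (-(3 : ℝ) / 4 + ε)) := by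
        rw [Finset.sum_const, nsmul_eq_mul]
        refine mul_le_mul_of_nonneg_right ?_ (mul_nonneg hC hy0)
        have := Finset.card_le_univ (univ.filter fun i : Fin k → Bool => i j₀ = false)
        simp only [Fintype.card_fun, Fintype.card_bool, Fintype.card_fin] at this
        exact_mod_cast this
    _ ≤ _ := by nlinarith

theorem stmt_8 (c : ℕ → ℝ) (hc0 : ∀ n, 0 ≤ c n)
    (hc : ∀ ε : ℝ, 0 < ε → ∃ K : ℝ, 0 < K ∧ ∀ n : ℕ, 1 ≤ n → c n ≤ K * (n : ℝ) ^ ε)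
    (k : ℕ) (hk : k = 3 ∨ k = 4 ∨ k = 5) (ε : ℝ) (hε : 0 < ε) :
    ∃ C : ℝ, 0 < C ∧
      ((∀ y : ℝ, 2 ≤ y →
        |(∑ i ∈ Finset.univ.filter (fun i : Fin k → Bool => i ⟨0, by omega⟩ = false),
            Real.cos (π * betaRS i / 4) *
              ∑ n ∈ Fintype.piFinset (fun _ : Fin k => Finset.Icc 1 ⌊y⌋₊),
                (if alphaRS n i = 0 then
                  (∏ j, c (n j)) / (∏ j, (n j : ℝ)) ^ ((7 : ℝ) / 8) else 0)) - BkRS c k| ≤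
          C * y ^ (-(3 : ℝ) / 4 + ε)) ∧
      ∀ T y : ℝ, 10 ≤ T → 2 ≤ y → y ≤ T →
        |(∫ x in T..(2 * T),
            x ^ ((9 * k : ℝ) / 8) *
              ∑ i ∈ Finset.univ.filter (fun i : Fin k → Bool => i ⟨0, by omega⟩ = false),
                Real.cos (-(π * betaRS i) / 4) *
                  ∑ n ∈ Fintype.piFinset (fun _ : Fin k => Finset.Icc 1 ⌊y⌋₊),
                    (if alphaRS n i = 0 then
                      (∏ j, c (n j)) / (∏ j, (n j : ℝ)) ^ ((7 : ℝ) / 8) else 0)) -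
          BkRS c k * ∫ x in T..(2 * T), x ^ ((9 * k : ℝ) / 8)| ≤
        C * T ^ (1 + 9 * (k : ℝ) / 8 + ε) * y ^ (-(3 : ℝ) / 4)) := by
  obtain ⟨C, hC, h⟩ := exists_abs_sum_signs_sub_BkRS_le hc0 hc (k := k) ⟨0, by omega⟩ hε
  have h2 : (1 : ℝ) ≤ 2 ^ (9 * (k : ℝ) / 8) := Real.one_le_rpow one_le_two (by positivity)
  refine ⟨C * 2 ^ (9 * (k : ℝ) / 8), by positivity, fun y hy => (h y hy).trans ?_,
    fun T y hT hy hyT => ?_⟩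
  · exact mul_le_mul_of_nonneg_right (le_mul_of_one_le_right hC.le h2) (by positivity)
  · have hT0 : 0 < T := by linarith
    have hy0 : 0 < y := by linarith
    rw [intervalIntegral.integral_mul_const]
    simp only [neg_div, Real.cos_neg]
    simp only [← neg_div]
    rw [mul_comm (∫ x in T..(2 * T), x ^ (9 * (k : ℝ) / 8)), ← sub_mul, abs_mul]
    calc _ ≤ (C * y ^ (-(3 : ℝ) / 4 + ε)) *
          (2 ^ (9 * (k : ℝ) / 8) * T ^ (1 + 9 * (k : ℝ) / 8)) :=
          mul_le_mul (h y hy) (integral_rpow_le hT0 (by positivity)) (abs_nonneg _) (by positivity)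
      _ ≤ (C * (y ^ (-(3 : ℝ) / 4) * T ^ ε)) *
          (2 ^ (9 * (k : ℝ) / 8) * T ^ (1 + 9 * (k : ℝ) / 8)) := by
          rw [Real.rpow_add hy0]
          have := Real.rpow_le_rpow hy0.le hyT hε.le
          gcongr
      _ = _ := by
          rw [Real.rpow_add hT0 _ ε]
          ring
end

section
/- Let k ∈ {3,4,5} and ε > 0. There is a constant C > 0 such that for every real T ≥ 10 and every real y with 2 ≤ y ≤ T, one has |∫_T^{2T} S₂(x) dx| ≤ C · T^{3/4 + 9k/8 + ε} · y^{4^{k−2} − 5/4 + k/8}, where S₂(x) = x^{9k/8} ∑_{i ∈ {0,1}^{k−1}} ∑_{n₁ ≤ y, …, n_k ≤ y, α(n;i) ≠ 0} (c_{n₁}⋯c_{n_k}/(n₁⋯n_k)^{7/8}) cos(8π α(n;i) x^{1/4} − πβ(i)/4). -/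
open scoped Classical
open Real Finset

section Conjugates

open Polynomial

theorem exists_eval₂_eq_even_add_odd {R S : Type*} [CommRing R] [CommRing S] (φ : R →+* S)
    (H : R[X]) :
    ∃ A B : R[X], ∀ y, H.eval₂ φ y = A.eval₂ φ (y ^ 2) + y * B.eval₂ φ (y ^ 2) := by
  induction H using Polynomial.induction_on with
  | C a => exact ⟨C a, 0, fun y => by simp⟩
  | add p q hp hq =>
    obtain ⟨A, B, h⟩ := hp
    obtain ⟨A', B', h'⟩ := hq
    refine ⟨A + A', B + B', fun y => ?_⟩
    simp only [eval₂_add, h, h']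
    ring
  | monomial n a hn =>
    obtain ⟨A, B, h⟩ := hn
    refine ⟨X * B, A, fun y => ?_⟩
    rw [pow_succ, ← mul_assoc, eval₂_mul, h, eval₂_X, eval₂_mul, eval₂_X]
    ring

theorem exists_eval₂_mul_eval₂_neg {R S : Type*} [CommRing R] [CommRing S] (φ : R →+* S)
    (H : R[X]) : ∃ L : R[X], ∀ y, H.eval₂ φ y * H.eval₂ φ (-y) = L.eval₂ φ (y ^ 2) := by
  obtain ⟨A, B, h⟩ := exists_eval₂_eq_even_add_odd φ H
  refine ⟨A ^ 2 - X * B ^ 2, fun y => ?_⟩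
  rw [h, h, neg_sq, eval₂_sub, eval₂_mul, eval₂_X, eval₂_pow, eval₂_pow]
  ring

theorem exists_prod_eval₂_fourth_roots {R S : Type*} [CommRing R] [CommRing S] (φ : R →+* S)
    {u : S} (hu : u ^ 2 = -1) (H : R[X]) :
    ∃ M : R[X], ∀ y, ∏ a : Fin 4, H.eval₂ φ (u ^ (a : ℕ) * y) = M.eval₂ φ (y ^ 4) := by
  obtain ⟨L, hL⟩ := exists_eval₂_mul_eval₂_neg φ H
  obtain ⟨M, hM⟩ := exists_eval₂_mul_eval₂_neg φ L
  refine ⟨M, fun y => ?_⟩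
  have h1 := hL (u * y)
  rw [mul_pow, hu, neg_one_mul] at h1
  have h2 := hM (y ^ 2)
  rw [← hL, ← h1, ← pow_mul] at h2
  have h3 : u ^ 3 = -u := by rw [pow_succ, hu]; ring
  simp only [Fin.prod_univ_four]
  simp only [Fin.isValue, Fin.coe_ofNat_eq_mod, Nat.zero_mod, Nat.one_mod, Nat.reduceMod, pow_zero,
    pow_one, one_mul, hu, h3, neg_mul]
  rw [← h2]
  ring

theorem exists_map_eq_prod_comp_fourth_roots (G : ℤ[X]) {n : ℤ} {t : ℂ} (ht : t ^ 4 = n) :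
    ∃ G' : ℤ[X], ∏ a : Fin 4, (G.map (Int.castRingHom ℂ)).comp (X - C (Complex.I ^ (a : ℕ) * t))
      = G'.map (Int.castRingHom ℂ) := by
  have hu : (C Complex.I : ℂ[X]) ^ 2 = -1 := by
    rw [← C_pow, Complex.I_sq, C_neg, C_1]
  obtain ⟨M, hM⟩ := exists_prod_eval₂_fourth_roots (mapRingHom (Int.castRingHom ℂ)) hu
    ((G.map C).comp (C X - X))
  refine ⟨M.eval (C n), ?_⟩
  have key := hM (C t)
  have hH : ∀ y : ℂ[X], ((G.map C).comp (C X - X)).eval₂ (mapRingHom (Int.castRingHom ℂ)) y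
      = (G.map (Int.castRingHom ℂ)).comp (X - y) := by
    intro y
    rw [eval₂_comp, eval₂_map, comp, eval₂_map]
    congr 1
    · ext
      simp
    · simp
  simp only [hH] at key
  simp only [C_mul, C_pow]
  rw [key, ← C_pow, ht, ← coe_mapRingHom, ← eval₂_id, hom_eval₂]
  simp

theorem exists_map_eq_prod_sub_conjugates {k : ℕ} (n : Fin k → ℤ) (t : Fin k → ℂ)
    (ht : ∀ j, t j ^ 4 = n j) :
    ∃ f : ℤ[X], ∏ a : Fin k → Fin 4, (X - C (∑ j, Complex.I ^ (a j : ℕ) * t j))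
      = f.map (Int.castRingHom ℂ) := by
  induction k with
  | zero => exact ⟨X, by simp⟩
  | succ k ih =>
    obtain ⟨f, hf⟩ := ih (fun j => n j.succ) (fun j => t j.succ) (fun j => ht j.succ)
    obtain ⟨g, hg⟩ := exists_map_eq_prod_comp_fourth_roots f (ht 0)
    refine ⟨g, ?_⟩
    rw [← hg, ← hf, ← (Fin.consEquiv (fun _ : Fin (k + 1) => Fin 4)).prod_comp,
      Fintype.prod_prod_type]
    refine Finset.prod_congr rfl fun x _ => ?_
    rw [Polynomial.prod_comp]
    refine Finset.prod_congr rfl fun a _ => ?_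
    simp [Fin.sum_univ_succ, Fin.consEquiv]
    ring

theorem one_le_prod_norm_of_int_coeff {ι : Type*} [Fintype ι] (v : ι → ℂ) (f : ℤ[X])
    (hf : ∏ a, (X - C (v a)) = f.map (Int.castRingHom ℂ)) :
    1 ≤ ∏ a with v a ≠ 0, ‖v a‖ := by
  have h1 : ∏ a, (X - C (v a)) =
      (∏ a with v a ≠ 0, (X - C (v a))) * X ^ (univ.filter fun a => ¬ v a ≠ 0).card := by
    rw [← Finset.prod_filter_mul_prod_filter_not univ (fun a => v a ≠ 0), ← Finset.prod_const]
    congr 1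
    refine Finset.prod_congr rfl fun a ha => ?_
    have : v a = 0 := by simpa using ha
    simp [this]
  have h2 := congrArg (fun p => ‖p.coeff (univ.filter fun a => ¬ v a ≠ 0).card‖) (h1.symm.trans hf)
  have h3 := coeff_mul_X_pow (∏ a with v a ≠ 0, (X - C (v a))) (univ.filter fun a => ¬ v a ≠ 0).card 0
  rw [zero_add] at h3
  simp only [h3, coeff_map, coeff_zero_eq_eval_zero, eval_prod, norm_prod] at h2
  simp only [eval_sub, eval_X, eval_C, zero_sub, norm_neg, eq_intCast, Complex.norm_intCast] at h2
  have hpos : 0 < ∏ a with v a ≠ 0, ‖v a‖ :=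
    Finset.prod_pos fun a ha => norm_pos_iff.2 (by simpa using ha)
  rw [h2] at hpos ⊢
  rw [← Int.cast_abs] at hpos ⊢
  exact_mod_cast Int.add_one_le_iff.2 (Int.cast_pos.1 hpos)

end Conjugates

theorem abs_integral_rpow_mul_cos_le {p A φ T : ℝ} (hp : 1 / 4 ≤ p) (hA : A ≠ 0) (hT : 1 ≤ T) :
    |∫ x in T..(2 * T), x ^ p * Real.cos (A * x ^ ((1 : ℝ) / 4) - φ)| ≤
      (4 * (p + 3) * 2 ^ (p + 3 / 4)) * T ^ (p + 3 / 4) / |A| := by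
  have hT0 : 0 < T := by linarith
  set q : ℝ := p + 3 / 4 with hq
  set F : ℝ → ℝ := fun x => 4 / A * (x ^ q * Real.sin (A * x ^ ((1 : ℝ) / 4) - φ)) with hF
  set g : ℝ → ℝ := fun x => 4 / A * (q * x ^ (q - 1) * Real.sin (A * x ^ ((1 : ℝ) / 4) - φ)) with hg
  set f : ℝ → ℝ := fun x => x ^ p * Real.cos (A * x ^ ((1 : ℝ) / 4) - φ) with hf
  have hcr : Continuous fun x : ℝ => A * x ^ ((1 : ℝ) / 4) - φ :=
    ((Real.continuous_rpow_const (by norm_num)).const_mul A).sub continuous_const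
  have hfc : Continuous f :=
    (Real.continuous_rpow_const (by linarith)).mul (Real.continuous_cos.comp hcr)
  have hgc : Continuous g :=
    (((Real.continuous_rpow_const (by linarith)).const_mul q).mul
      (Real.continuous_sin.comp hcr)).const_mul _
  have hle : T ≤ 2 * T := by linarith
  have hderiv : ∀ x ∈ Set.uIcc T (2 * T), HasDerivAt F (f x + g x) x := by
    intro x hx
    rw [Set.uIcc_of_le hle] at hx
    have hx0 : 0 < x := lt_of_lt_of_le hT0 hx.1
    have h1 := (Real.hasDerivAt_rpow_const (x := x) (p := q) (Or.inl hx0.ne'))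
    have h2 := (((Real.hasDerivAt_rpow_const (x := x) (p := (1 : ℝ) / 4)
      (Or.inl hx0.ne')).const_mul A).sub_const φ).sin
    have h3 := (h1.mul h2).const_mul (4 / A)
    refine h3.congr_deriv ?_
    have e : x ^ p = x ^ q * x ^ ((1 : ℝ) / 4 - 1) := by
      rw [← Real.rpow_add hx0]
      congr 1
      rw [hq]
      ring
    simp only [hf, hg, e]
    field_simp
    ring
  have hint := intervalIntegral.integral_eq_sub_of_hasDerivAt hderiv
    ((hfc.add hgc).intervalIntegrable _ _)
  rw [intervalIntegral.integral_add (hfc.intervalIntegrable _ _) (hgc.intervalIntegrable _ _)]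
    at hint
  have hApos : 0 < |A| := abs_pos.2 hA
  have hqpos : 1 ≤ q := by rw [hq]; linarith
  have hFb : ∀ x, 0 < x → x ≤ 2 * T → |F x| ≤ 4 / |A| * (2 * T) ^ q := by
    intro x hx hx2
    simp only [hF]
    rw [abs_mul, abs_div, abs_mul, abs_of_pos (by norm_num : (0 : ℝ) < 4)]
    gcongr
    rw [← mul_one ((2 * T) ^ q)]
    gcongr
    · rw [abs_of_pos (Real.rpow_pos_of_pos hx q)]
      gcongr
    · exact Real.abs_sin_le_one _
  have hgb : |∫ x in T..(2 * T), g x| ≤ 4 / |A| * (q * (2 * T) ^ q) := by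
    have h := intervalIntegral.norm_integral_le_of_norm_le_const (a := T) (b := 2 * T) (f := g)
      (C := 4 / |A| * (q * (2 * T) ^ (q - 1))) ?_
    · rw [Real.norm_eq_abs, show 2 * T - T = T by ring, abs_of_pos hT0] at h
      refine h.trans ?_
      have e : (2 * T) ^ q = (2 * T) ^ (q - 1) * (2 * T) := by
        rw [← Real.rpow_add_one (by positivity)]
        congr 1
        ring
      rw [e, mul_assoc, mul_assoc]
      have : 0 ≤ (2 * T) ^ (q - 1) := by positivity
      gcongr
    · intro x hx
      rw [Set.uIoc_of_le hle] at hx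
      have hx0 : 0 < x := lt_trans hT0 hx.1
      simp only [hg]
      rw [Real.norm_eq_abs, abs_mul, abs_div, abs_of_pos (by norm_num : (0 : ℝ) < 4)]
      gcongr
      have h5 : |x ^ (q - 1)| ≤ (2 * T) ^ (q - 1) := by
        rw [abs_of_pos (by positivity)]
        gcongr
        exact hx.2
      rw [abs_mul, abs_mul, abs_of_pos (by linarith : 0 < q)]
      refine (mul_le_of_le_one_right (by positivity) (Real.abs_sin_le_one _)).trans ?_
      gcongr
  have hF1 := hFb T hT0 hle
  have hF2 := hFb (2 * T) (by positivity) le_rfl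
  have e : ∫ x in T..(2 * T), f x = F (2 * T) - F T - ∫ x in T..(2 * T), g x := by linarith
  have e2 : (4 * (p + 3) * 2 ^ q) * T ^ q / |A| =
      4 / |A| * (2 * T) ^ q + 4 / |A| * (2 * T) ^ q + 4 / |A| * (q * (2 * T) ^ q)
        + 4 / |A| * (2 * T) ^ q / 4 := by
    rw [Real.mul_rpow (by norm_num) hT0.le, hq]
    ring
  rw [e, e2]
  have h4 : 0 ≤ 4 / |A| * (2 * T) ^ q / 4 := by positivity
  have := abs_sub (F (2 * T) - F T) (∫ x in T..(2 * T), g x)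
  have := abs_sub (F (2 * T)) (F T)
  linarith

theorem norm_sum_I_pow_mul_le {k : ℕ} (n : Fin k → ℕ) {M : ℝ} (hn : ∀ j, (n j : ℝ) ≤ M)
    (a : Fin k → Fin 4) :
    ‖∑ j, Complex.I ^ (a j : ℕ) * (((n j : ℝ) ^ ((1 : ℝ) / 4) : ℝ) : ℂ)‖ ≤
      k * M ^ ((1 : ℝ) / 4) := by
  refine (norm_sum_le _ _).trans ?_
  refine (Finset.sum_le_card_nsmul _ _ (M ^ ((1 : ℝ) / 4)) fun j _ => ?_).trans (by simp)
  rw [norm_mul, norm_pow, Complex.norm_I, one_pow, one_mul, Complex.norm_real, Real.norm_eq_abs,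
    abs_of_nonneg (by positivity)]
  gcongr
  exact hn j

theorem one_le_abs_alphaRS_mul {k : ℕ} (n : Fin (k + 1) → ℕ) (i : Fin (k + 1) → Bool) {M : ℝ}
    (hM : 1 ≤ M) (hn : ∀ j, (n j : ℝ) ≤ M) (hα : alphaRS n i ≠ 0) :
    1 ≤ |alphaRS n i| * ((k + 1 : ℕ) * M ^ ((1 : ℝ) / 4)) ^ (4 ^ k - 1) := by
  set t : Fin (k + 1) → ℂ := fun j => (((n j : ℝ) ^ ((1 : ℝ) / 4) : ℝ) : ℂ) with ht
  set v : (Fin (k + 1) → Fin 4) → ℂ := fun a => ∑ j, Complex.I ^ (a j : ℕ) * t j with hv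
  set B : ℝ := (k + 1 : ℕ) * M ^ ((1 : ℝ) / 4) with hB
  have hB1 : 1 ≤ B := by
    have h1 : (1 : ℝ) ≤ (k + 1 : ℕ) := by simp
    have h2 : 1 ≤ M ^ ((1 : ℝ) / 4) := Real.one_le_rpow hM (by norm_num)
    exact one_le_mul_of_one_le_of_one_le h1 h2
  have ht4 : ∀ j, t j ^ 4 = ((n j : ℤ) : ℂ) := by
    intro j
    simp only [ht]
    rw [← Complex.ofReal_pow, ← Real.rpow_natCast, ← Real.rpow_mul (by positivity)]
    norm_num
  obtain ⟨f, hf⟩ := exists_map_eq_prod_sub_conjugates (fun j => (n j : ℤ)) t ht4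
  have h1 : 1 ≤ ∏ a with v a ≠ 0, ‖v a‖ := one_le_prod_norm_of_int_coeff v f hf
  set a₀ : Fin (k + 1) → Fin 4 := fun j => if i j then 2 else 0 with ha₀
  have hv₀ : v a₀ = (alphaRS n i : ℂ) := by
    simp only [hv, ha₀, alphaRS, ht, Complex.ofReal_sum, Complex.ofReal_mul]
    refine Finset.sum_congr rfl fun j _ => ?_
    congr 1
    split_ifs <;> simp
  set r : Fin 4 → Fin (k + 1) → Fin 4 := fun b j => a₀ j + b with hr
  have hI : ∀ x b : Fin 4,
      Complex.I ^ ((x + b : Fin 4) : ℕ) = Complex.I ^ (b : ℕ) * Complex.I ^ (x : ℕ) := by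
    intro x b
    rw [Fin.val_add, ← Complex.I_pow_eq_pow_mod, pow_add, mul_comm]
  have hvr : ∀ b, ‖v (r b)‖ = |alphaRS n i| := by
    intro b
    have : v (r b) = Complex.I ^ (b : ℕ) * v a₀ := by
      simp only [hv, hr, hI, Finset.mul_sum, mul_assoc]
    rw [this, hv₀, norm_mul, norm_pow, Complex.norm_I, one_pow, one_mul, Complex.norm_real,
      Real.norm_eq_abs]
  have hrinj : Function.Injective r := by
    intro b b' h
    exact add_left_cancel (congrFun h 0)
  set R := Finset.univ.image r with hR
  have hRcard : R.card = 4 := by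
    rw [hR, Finset.card_image_of_injective _ hrinj]
    simp
  have hRsub : R ⊆ univ.filter fun a => v a ≠ 0 := by
    intro a ha
    obtain ⟨b, -, rfl⟩ := Finset.mem_image.1 ha
    simp only [Finset.mem_filter, Finset.mem_univ, true_and]
    rw [← norm_pos_iff, hvr]
    exact abs_pos.2 hα
  rw [← Finset.prod_sdiff hRsub] at h1
  have h2 : ∏ a ∈ R, ‖v a‖ = |alphaRS n i| ^ 4 := by
    rw [hR, Finset.prod_image hrinj.injOn]
    simp [hvr]
  have h3 : ∏ a ∈ (univ.filter fun a => v a ≠ 0) \ R, ‖v a‖ ≤ (B ^ (4 ^ k - 1)) ^ 4 := by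
    calc ∏ a ∈ (univ.filter fun a => v a ≠ 0) \ R, ‖v a‖
        ≤ ∏ a ∈ (univ.filter fun a => v a ≠ 0) \ R, B :=
          Finset.prod_le_prod (fun _ _ => norm_nonneg _) fun a _ =>
            norm_sum_I_pow_mul_le n hn a
      _ ≤ (B ^ (4 ^ k - 1)) ^ 4 := by
          rw [Finset.prod_const, ← pow_mul]
          refine pow_le_pow_right₀ hB1 ?_
          have h4 : ((univ.filter fun a => v a ≠ 0) \ R).card ≤ (univ \ R).card :=
            Finset.card_le_card (Finset.sdiff_subset_sdiff (Finset.filter_subset _ _) le_rfl)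
          rw [← Finset.compl_eq_univ_sdiff, Finset.card_compl, hRcard] at h4
          simp only [Fintype.card_pi, Fintype.card_fin, Finset.prod_const, Finset.card_univ] at h4
          rw [pow_succ] at h4
          omega
  rw [h2] at h1
  have h5 : 1 ≤ (|alphaRS n i| * B ^ (4 ^ k - 1)) ^ 4 := by
    rw [mul_pow, mul_comm]
    exact h1.trans (by gcongr)
  exact (one_le_pow_iff_of_nonneg (by positivity) (by norm_num)).1 h5

theorem eq_of_abs_rpow_sub_rpow_lt {a b : ℕ} {y : ℝ} (ha : (a : ℝ) ≤ y) (hb : (b : ℝ) ≤ y)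
    (hy : 0 < y)
    (h : |(a : ℝ) ^ ((1 : ℝ) / 4) - (b : ℝ) ^ ((1 : ℝ) / 4)| < 1 / (4 * y ^ ((3 : ℝ) / 4))) :
    a = b := by
  wlog hab : b < a generalizing a b with H
  · rcases (not_lt.1 hab).lt_or_eq with h' | h'
    · exact (H hb ha (by rwa [abs_sub_comm]) h').symm
    · exact h'
  exfalso
  set s := (a : ℝ) ^ ((1 : ℝ) / 4) with hs
  set u := (b : ℝ) ^ ((1 : ℝ) / 4) with hu
  set z := y ^ ((1 : ℝ) / 4) with hz
  have hs4 : s ^ 4 = a := by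
    rw [hs, ← Real.rpow_natCast, ← Real.rpow_mul (by positivity)]
    norm_num
  have hu4 : u ^ 4 = b := by
    rw [hu, ← Real.rpow_natCast, ← Real.rpow_mul (by positivity)]
    norm_num
  have hz3 : y ^ ((3 : ℝ) / 4) = z ^ 3 := by
    rw [hz, ← Real.rpow_natCast, ← Real.rpow_mul hy.le]
    norm_num
  have hz0 : 0 < z := Real.rpow_pos_of_pos hy _
  have hs0 : 0 ≤ s := by positivity
  have hu0 : 0 ≤ u := by positivity
  have hsz : s ≤ z := by
    rw [hs, hz]
    gcongr
  have hab' : (b : ℝ) + 1 ≤ a := by exact_mod_cast hab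
  have hus : u ≤ s := by
    rw [hu, hs]
    gcongr
  rw [hz3, lt_div_iff₀ (by positivity)] at h
  have h6 : s - u ≤ |s - u| := le_abs_self _
  have h7 : s ^ 4 - u ^ 4 ≤ (s - u) * (4 * z ^ 3) := by
    have e : s ^ 4 - u ^ 4 = (s - u) * (s ^ 3 + s ^ 2 * u + s * u ^ 2 + u ^ 3) := by ring
    rw [e]
    refine mul_le_mul_of_nonneg_left ?_ (by linarith)
    have huz : u ≤ z := hus.trans hsz
    have : s ^ 3 ≤ z ^ 3 := by gcongr
    have : s ^ 2 * u ≤ z ^ 2 * z := by gcongr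
    have : s * u ^ 2 ≤ z * z ^ 2 := by gcongr
    have : u ^ 3 ≤ z ^ 3 := by gcongr
    nlinarith
  have h8 : (s - u) * (4 * z ^ 3) ≤ |s - u| * (4 * z ^ 3) := by gcongr
  linarith

theorem sum_Icc_rpow_neg_le (N : ℕ) :
    ∑ n ∈ Finset.Icc 1 N, (n : ℝ) ^ (-(7 / 8) : ℝ) ≤ 8 * (N : ℝ) ^ ((1 : ℝ) / 8) := by
  induction N with
  | zero => simp
  | succ N ih =>
    rw [Finset.sum_Icc_succ_top (by omega)]
    set s := ((N + 1 : ℕ) : ℝ) ^ ((1 : ℝ) / 8) with hs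
    set u := (N : ℝ) ^ ((1 : ℝ) / 8) with hu
    have hpos : (0 : ℝ) < (N + 1 : ℕ) := by positivity
    have hs8 : s ^ 8 = N + 1 := by
      rw [hs, ← Real.rpow_natCast, ← Real.rpow_mul (by positivity)]
      norm_num
    have hu8 : u ^ 8 = N := by
      rw [hu, ← Real.rpow_natCast, ← Real.rpow_mul (by positivity)]
      norm_num
    have hs7 : ((N + 1 : ℕ) : ℝ) ^ (-(7 / 8) : ℝ) = (s ^ 7)⁻¹ := by
      rw [Real.rpow_neg hpos.le, hs, ← Real.rpow_natCast, ← Real.rpow_mul (by positivity)]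
      norm_num
    have hs0 : 0 < s := Real.rpow_pos_of_pos hpos _
    have hu0 : 0 ≤ u := by positivity
    have hus : u ≤ s := by
      rw [hu, hs]
      gcongr
      simp
    have h1 : s ^ 8 - u ^ 8 ≤ (s - u) * (8 * s ^ 7) := by
      have e : s ^ 8 - u ^ 8 = (s - u) * (s ^ 7 + s ^ 6 * u + s ^ 5 * u ^ 2 + s ^ 4 * u ^ 3
        + s ^ 3 * u ^ 4 + s ^ 2 * u ^ 5 + s * u ^ 6 + u ^ 7) := by ring
      rw [e]
      refine mul_le_mul_of_nonneg_left ?_ (by linarith)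
      have : s ^ 6 * u ≤ s ^ 6 * s := by gcongr
      have : s ^ 5 * u ^ 2 ≤ s ^ 5 * s ^ 2 := by gcongr
      have : s ^ 4 * u ^ 3 ≤ s ^ 4 * s ^ 3 := by gcongr
      have : s ^ 3 * u ^ 4 ≤ s ^ 3 * s ^ 4 := by gcongr
      have : s ^ 2 * u ^ 5 ≤ s ^ 2 * s ^ 5 := by gcongr
      have : s * u ^ 6 ≤ s * s ^ 6 := by gcongr
      have : u ^ 7 ≤ s ^ 7 := by gcongr
      nlinarith
    have h2 : (s ^ 7)⁻¹ ≤ 8 * (s - u) := by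
      rw [inv_le_iff_one_le_mul₀ (by positivity)]
      linarith
    rw [hs7]
    linarith

theorem sum_piFinset_prod_rpow_le (k : ℕ) {y : ℝ} (hy : 0 ≤ y) :
    ∑ n ∈ Fintype.piFinset (fun _ : Fin k => Finset.Icc 1 ⌊y⌋₊),
      ∏ j, (n j : ℝ) ^ (-(7 / 8) : ℝ) ≤ 8 ^ k * y ^ ((k : ℝ) / 8) := by
  rw [← Finset.prod_univ_sum (fun _ : Fin k => Finset.Icc 1 ⌊y⌋₊)
    (fun _ n => (n : ℝ) ^ (-(7 / 8) : ℝ)), Finset.prod_const, Finset.card_univ, Fintype.card_fin]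
  have e : (8 : ℝ) ^ k * y ^ ((k : ℝ) / 8) = (8 * y ^ ((1 : ℝ) / 8)) ^ k := by
    rw [mul_pow, ← Real.rpow_natCast (y ^ ((1 : ℝ) / 8)), ← Real.rpow_mul hy]
    congr 2
    ring
  rw [e]
  gcongr
  refine (sum_Icc_rpow_neg_le _).trans ?_
  gcongr
  exact Nat.floor_le hy

theorem alphaRS_sub_alphaRS {k : ℕ} {n n' : Fin (k + 1) → ℕ} (i : Fin (k + 1) → Bool)
    (j : Fin (k + 1)) (h : ∀ l, n (j.succAbove l) = n' (j.succAbove l)) :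
    |alphaRS n i - alphaRS n' i| =
      |(n j : ℝ) ^ ((1 : ℝ) / 4) - (n' j : ℝ) ^ ((1 : ℝ) / 4)| := by
  unfold alphaRS
  rw [Fin.sum_univ_succAbove _ j, Fin.sum_univ_succAbove _ j]
  simp only [h]
  rw [add_sub_add_right_eq_sub, ← mul_sub, abs_mul]
  split_ifs <;> simp

theorem sum_small_alphaRS_le {k : ℕ} (i : Fin (k + 1) → Bool) (j : Fin (k + 1)) {y : ℝ}
    (hy : 0 < y) :
    ∑ n ∈ Fintype.piFinset (fun _ : Fin (k + 1) => Finset.Icc 1 ⌊y⌋₊),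
      (if |alphaRS n i| < 1 / (8 * y ^ ((3 : ℝ) / 4)) then
        ∏ l, (n (j.succAbove l) : ℝ) ^ (-(7 / 8) : ℝ) else 0) ≤ 8 ^ k * y ^ ((k : ℝ) / 8) := by
  refine le_trans ?_ (sum_piFinset_prod_rpow_le k hy.le)
  rw [← Finset.sum_filter]
  have hinj : Set.InjOn (fun (n : Fin (k + 1) → ℕ) l => n (j.succAbove l))
      ((Fintype.piFinset (fun _ : Fin (k + 1) => Finset.Icc 1 ⌊y⌋₊)).filter
        fun n => |alphaRS n i| < 1 / (8 * y ^ ((3 : ℝ) / 4)) : Finset (Fin (k + 1) → ℕ)) := by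
    intro n hn n' hn' h
    simp only [Finset.coe_filter, Fintype.mem_piFinset, Finset.mem_Icc, Set.mem_ofPred_eq] at hn hn'
    have hl : ∀ l, n (j.succAbove l) = n' (j.succAbove l) := fun l => congrFun h l
    have hj : n j = n' j := by
      refine eq_of_abs_rpow_sub_rpow_lt ((Nat.le_floor_iff hy.le).1 (hn.1 j).2)
        ((Nat.le_floor_iff hy.le).1 (hn'.1 j).2) hy ?_
      rw [← alphaRS_sub_alphaRS i j hl]
      have e : 1 / (4 * y ^ ((3 : ℝ) / 4)) =
          1 / (8 * y ^ ((3 : ℝ) / 4)) + 1 / (8 * y ^ ((3 : ℝ) / 4)) := by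
        have : 0 < y ^ ((3 : ℝ) / 4) := Real.rpow_pos_of_pos hy _
        field_simp
        norm_num
      rw [e]
      exact (abs_sub _ _).trans_lt (add_lt_add hn.2 hn'.2)
    funext l
    rcases Fin.eq_self_or_eq_succAbove j l with rfl | ⟨l, rfl⟩
    · exact hj
    · exact hl l
  rw [← Finset.sum_image (f := fun m : Fin k → ℕ => ∏ l, (m l : ℝ) ^ (-(7 / 8) : ℝ)) hinj]
  refine Finset.sum_le_sum_of_subset_of_nonneg ?_ fun m _ _ => by positivity
  intro m hm
  obtain ⟨n, hn, rfl⟩ := Finset.mem_image.1 hm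
  rw [Finset.mem_filter, Fintype.mem_piFinset] at hn
  exact Fintype.mem_piFinset.2 fun l => hn.1 _

theorem inv_abs_alphaRS_mul_prod_le {k : ℕ} (hk : 2 ≤ k) (i : Fin (k + 1) → Bool) {y : ℝ}
    (hy : 1 ≤ y) {n : Fin (k + 1) → ℕ}
    (hn : n ∈ Fintype.piFinset (fun _ : Fin (k + 1) => Finset.Icc 1 ⌊y⌋₊))
    (hα : alphaRS n i ≠ 0) :
    (∏ j, (n j : ℝ) ^ (-(7 / 8) : ℝ)) / |alphaRS n i| ≤
      8 * y ^ ((3 : ℝ) / 4) * ∏ j, (n j : ℝ) ^ (-(7 / 8) : ℝ) +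
      ∑ j : Fin (k + 1), (k + 1 : ℕ) ^ (4 ^ k - 1) * y ^ ((4 : ℝ) ^ (k - 1) - 9 / 8) *
        (if |alphaRS n i| < 1 / (8 * y ^ ((3 : ℝ) / 4)) then
          ∏ l, (n (j.succAbove l) : ℝ) ^ (-(7 / 8) : ℝ) else 0) := by
  have hy0 : 0 < y := by linarith
  have hαpos : 0 < |alphaRS n i| := abs_pos.2 hα
  rw [Fintype.mem_piFinset] at hn
  simp only [Finset.mem_Icc, Nat.le_floor_iff hy0.le] at hn
  by_cases h : |alphaRS n i| < 1 / (8 * y ^ ((3 : ℝ) / 4))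
  · simp only [h, if_true]
    obtain ⟨j, -, hj⟩ := Finset.exists_max_image univ n univ_nonempty
    have hle := Finset.single_le_sum (f := fun j => ((k + 1 : ℕ) : ℝ) ^ (4 ^ k - 1) *
      y ^ ((4 : ℝ) ^ (k - 1) - 9 / 8) * ∏ l, (n (j.succAbove l) : ℝ) ^ (-(7 / 8) : ℝ))
      (fun j _ => by positivity) (Finset.mem_univ j)
    refine le_trans ?_ (hle.trans (le_add_of_nonneg_left (by positivity)))
    have hnj1 : (1 : ℝ) ≤ n j := by exact_mod_cast (hn j).1
    have hnj0 : (0 : ℝ) < n j := by linarith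
    have h1 := one_le_abs_alphaRS_mul n i (M := n j) hnj1
      (fun l => by exact_mod_cast hj l (Finset.mem_univ l)) hα
    have hcast : ((4 ^ k - 1 : ℕ) : ℝ) = 4 * 4 ^ (k - 1) - 1 := by
      rw [Nat.cast_sub (Nat.one_le_pow _ _ (by norm_num))]
      obtain ⟨m, rfl⟩ : ∃ m, k = m + 1 := ⟨k - 1, by omega⟩
      push_cast
      ring
    have hpow : (((n j : ℝ)) ^ ((1 : ℝ) / 4)) ^ (4 ^ k - 1) =
        (n j : ℝ) ^ ((4 : ℝ) ^ (k - 1) - 1 / 4) := by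
      rw [← Real.rpow_natCast, ← Real.rpow_mul hnj0.le, hcast]
      congr 1
      ring
    rw [mul_pow, hpow] at h1
    rw [Fin.prod_univ_succAbove _ j, div_le_iff₀ hαpos]
    have h44 : (4 : ℝ) ≤ 4 ^ (k - 1) := by
      calc (4 : ℝ) = 4 ^ 1 := (pow_one _).symm
        _ ≤ 4 ^ (k - 1) := pow_le_pow_right₀ (by norm_num) (by omega)
    set W := ∏ l, (n (j.succAbove l) : ℝ) ^ (-(7 / 8) : ℝ) with hW
    have hW0 : 0 ≤ W := by positivity
    have hsplit : (n j : ℝ) ^ (-(7 / 8) : ℝ) * (n j : ℝ) ^ ((4 : ℝ) ^ (k - 1) - 1 / 4) =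
        (n j : ℝ) ^ ((4 : ℝ) ^ (k - 1) - 9 / 8) := by
      rw [← Real.rpow_add hnj0]
      congr 1
      ring
    have hmono : (n j : ℝ) ^ ((4 : ℝ) ^ (k - 1) - 9 / 8) ≤ y ^ ((4 : ℝ) ^ (k - 1) - 9 / 8) :=
      Real.rpow_le_rpow hnj0.le (hn j).2 (by linarith)
    calc (n j : ℝ) ^ (-(7 / 8) : ℝ) * W
        ≤ (n j : ℝ) ^ (-(7 / 8) : ℝ) * W * (|alphaRS n i| * (((k + 1 : ℕ) : ℝ) ^ (4 ^ k - 1) *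
            (n j : ℝ) ^ ((4 : ℝ) ^ (k - 1) - 1 / 4))) :=
          le_mul_of_one_le_right (by positivity) h1
      _ = ((k + 1 : ℕ) : ℝ) ^ (4 ^ k - 1) * ((n j : ℝ) ^ (-(7 / 8) : ℝ) *
            (n j : ℝ) ^ ((4 : ℝ) ^ (k - 1) - 1 / 4)) * W * |alphaRS n i| := by ring
      _ ≤ _ := by
          rw [hsplit]
          gcongr
  · simp only [h, if_false, mul_zero, Finset.sum_const_zero, add_zero]
    rw [div_le_iff₀ hαpos]
    have hz : 0 < y ^ ((3 : ℝ) / 4) := Real.rpow_pos_of_pos hy0 _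
    rw [not_lt, div_le_iff₀ (by positivity)] at h
    have hw : 0 ≤ ∏ j, (n j : ℝ) ^ (-(7 / 8) : ℝ) := by positivity
    nlinarith

theorem sum_prod_div_abs_alphaRS_le {k : ℕ} (hk : 2 ≤ k) (i : Fin (k + 1) → Bool) {y : ℝ}
    (hy : 1 ≤ y) :
    ∑ n ∈ Fintype.piFinset (fun _ : Fin (k + 1) => Finset.Icc 1 ⌊y⌋₊),
      (if alphaRS n i ≠ 0 then (∏ j, (n j : ℝ) ^ (-(7 / 8) : ℝ)) / |alphaRS n i| else 0) ≤
    (8 ^ (k + 2) + (k + 1 : ℕ) ^ (4 ^ k) * 8 ^ k) *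
      y ^ ((4 : ℝ) ^ (k - 1) - 5 / 4 + (k + 1 : ℕ) / 8) := by
  have hy0 : 0 < y := by linarith
  have h44 : (4 : ℝ) ≤ 4 ^ (k - 1) := by
    calc (4 : ℝ) = 4 ^ 1 := (pow_one _).symm
      _ ≤ 4 ^ (k - 1) := pow_le_pow_right₀ (by norm_num) (by omega)
  calc _ ≤ ∑ n ∈ Fintype.piFinset (fun _ : Fin (k + 1) => Finset.Icc 1 ⌊y⌋₊),
        (8 * y ^ ((3 : ℝ) / 4) * ∏ j, (n j : ℝ) ^ (-(7 / 8) : ℝ) +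
        ∑ j : Fin (k + 1), (k + 1 : ℕ) ^ (4 ^ k - 1) * y ^ ((4 : ℝ) ^ (k - 1) - 9 / 8) *
          (if |alphaRS n i| < 1 / (8 * y ^ ((3 : ℝ) / 4)) then
            ∏ l, (n (j.succAbove l) : ℝ) ^ (-(7 / 8) : ℝ) else 0)) := by
        refine Finset.sum_le_sum fun n hn => ?_
        by_cases h : alphaRS n i = 0
        · rw [if_neg (not_not.2 h)]
          positivity
        · rw [if_pos h]
          exact inv_abs_alphaRS_mul_prod_le hk i hy hn h
    _ ≤ 8 * y ^ ((3 : ℝ) / 4) * (8 ^ (k + 1) * y ^ (((k + 1 : ℕ) : ℝ) / 8)) +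
        ∑ j : Fin (k + 1), (k + 1 : ℕ) ^ (4 ^ k - 1) * y ^ ((4 : ℝ) ^ (k - 1) - 9 / 8) *
          (8 ^ k * y ^ ((k : ℝ) / 8)) := by
        rw [Finset.sum_add_distrib, ← Finset.mul_sum, Finset.sum_comm]
        refine add_le_add ?_ (Finset.sum_le_sum fun j _ => ?_)
        · gcongr
          exact sum_piFinset_prod_rpow_le (k + 1) hy0.le
        · rw [← Finset.mul_sum]
          gcongr
          exact sum_small_alphaRS_le i j hy0
    _ = 8 ^ (k + 2) * y ^ ((3 : ℝ) / 4 + ((k + 1 : ℕ) : ℝ) / 8) +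
        (k + 1 : ℕ) ^ (4 ^ k) * 8 ^ k * y ^ ((4 : ℝ) ^ (k - 1) - 9 / 8 + (k : ℝ) / 8) := by
        rw [Real.rpow_add hy0, Real.rpow_add hy0, Finset.sum_const, Finset.card_univ,
          Fintype.card_fin, nsmul_eq_mul]
        have e : (((k + 1 : ℕ) : ℝ)) ^ (4 ^ k) =
            ((k + 1 : ℕ) : ℝ) * ((k + 1 : ℕ) : ℝ) ^ (4 ^ k - 1) :=
          (mul_pow_sub_one (by positivity) _).symm
        rw [e]
        ring
    _ ≤ _ := by
        rw [add_mul]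
        refine add_le_add (mul_le_mul_of_nonneg_left ?_ (by positivity))
          (mul_le_mul_of_nonneg_left ?_ (by positivity))
        · exact Real.rpow_le_rpow_of_exponent_le hy (by linarith)
        · refine Real.rpow_le_rpow_of_exponent_le hy ?_
          push_cast
          linarith

theorem prod_coeff_le {k : ℕ} {c : ℕ → ℝ} (hc0 : ∀ n, 0 ≤ c n) {K ε T : ℝ}
    (hε : 0 ≤ ε) (hc : ∀ n : ℕ, 1 ≤ n → c n ≤ K * (n : ℝ) ^ (ε / k)) (hk : 0 < k)
    (hK : 0 < K) (hT : 0 ≤ T) {n : Fin k → ℕ} (hn : ∀ j, 1 ≤ n j ∧ (n j : ℝ) ≤ T) :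
    ∏ j, c (n j) ≤ K ^ k * T ^ ε := by
  calc ∏ j, c (n j) ≤ ∏ _j : Fin k, K * T ^ (ε / k) := by
        refine Finset.prod_le_prod (fun _ _ => hc0 _) fun j _ => (hc _ (hn j).1).trans ?_
        gcongr
        exact (hn j).2
    _ = K ^ k * T ^ ε := by
        rw [Finset.prod_const, Finset.card_univ, Fintype.card_fin, mul_pow,
          ← Real.rpow_natCast (T ^ (ε / k)), ← Real.rpow_mul hT,
          div_mul_cancel₀ _ (by exact_mod_cast hk.ne')]

theorem abs_integral_term_le {k : ℕ} {c : ℕ → ℝ} (hc0 : ∀ n, 0 ≤ c n) {A T : ℝ}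
    (hT : 1 ≤ T) {n : Fin k → ℕ}
    (hA : ∏ j, c (n j) ≤ A) (i : Fin k → Bool) {p : ℝ} (hp : 1 / 4 ≤ p) (φ : ℝ) :
    |∫ x in T..(2 * T), x ^ p * (if alphaRS n i ≠ 0 then
        ((∏ j, c (n j)) / (∏ j, (n j : ℝ)) ^ ((7 : ℝ) / 8)) *
          Real.cos (8 * π * alphaRS n i * x ^ ((1 : ℝ) / 4) - φ) else 0)| ≤
      A * (4 * (p + 3) * 2 ^ (p + 3 / 4)) * T ^ (p + 3 / 4) *
      (if alphaRS n i ≠ 0 then (∏ j, (n j : ℝ) ^ (-(7 / 8) : ℝ)) / |alphaRS n i| else 0) := by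
  split_ifs with h
  · have hw : (∏ j, c (n j)) / (∏ j, (n j : ℝ)) ^ ((7 : ℝ) / 8) =
        (∏ j, c (n j)) * ∏ j, (n j : ℝ) ^ (-(7 / 8) : ℝ) := by
      rw [Real.finsetProd_rpow _ _ (fun j _ => Nat.cast_nonneg _), Real.rpow_neg (by positivity),
        div_eq_mul_inv]
    rw [hw]
    set P := ∏ j, c (n j) with hP
    set w := ∏ j, (n j : ℝ) ^ (-(7 / 8) : ℝ) with hw'
    have hP0 : 0 ≤ P := Finset.prod_nonneg fun j _ => hc0 _
    have hw0 : 0 ≤ w := by positivity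
    have hI := abs_integral_rpow_mul_cos_le (A := 8 * π * alphaRS n i) (φ := φ) hp
      (mul_ne_zero (by positivity) h) hT
    have e : ∀ x : ℝ, x ^ p * (P * w * Real.cos (8 * π * alphaRS n i * x ^ ((1 : ℝ) / 4) - φ)) =
        P * w * (x ^ p * Real.cos (8 * π * alphaRS n i * x ^ ((1 : ℝ) / 4) - φ)) := fun x => by ring
    simp only [e]
    rw [intervalIntegral.integral_const_mul, abs_mul, abs_of_nonneg (by positivity)]
    have hα : 0 < |alphaRS n i| := abs_pos.2 h
    have h8 : |alphaRS n i| ≤ |8 * π * alphaRS n i| := by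
      rw [abs_mul, abs_of_pos (by positivity : 0 < 8 * π)]
      refine le_mul_of_one_le_left hα.le ?_
      linarith [Real.pi_gt_three]
    have hp3 : 0 ≤ p + 3 := by linarith
    calc P * w * |∫ x in T..(2 * T),
          x ^ p * Real.cos (8 * π * alphaRS n i * x ^ ((1 : ℝ) / 4) - φ)|
        ≤ A * w * ((4 * (p + 3) * 2 ^ (p + 3 / 4)) * T ^ (p + 3 / 4) / |alphaRS n i|) := by
          have hA0 : 0 ≤ A := hP0.trans hA
          gcongr
          refine hI.trans ?_
          gcongr
      _ = _ := by ring
  · simp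

theorem stmt_9 (c : ℕ → ℝ) (hc0 : ∀ n, 0 ≤ c n)
    (hc : ∀ ε : ℝ, 0 < ε → ∃ K : ℝ, 0 < K ∧ ∀ n : ℕ, 1 ≤ n → c n ≤ K * (n : ℝ) ^ ε)
    (k : ℕ) (hk : k = 3 ∨ k = 4 ∨ k = 5) (ε : ℝ) (hε : 0 < ε) :
    ∃ C : ℝ, 0 < C ∧ ∀ T y : ℝ, 10 ≤ T → 2 ≤ y → y ≤ T →
      |∫ x in T..(2 * T),
          x ^ ((9 * k : ℝ) / 8) *
            ∑ i ∈ Finset.univ.filter (fun i : Fin k → Bool => i ⟨0, by omega⟩ = false),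
              ∑ n ∈ Fintype.piFinset (fun _ : Fin k => Finset.Icc 1 ⌊y⌋₊),
                (if alphaRS n i ≠ 0 then
                  ((∏ j, c (n j)) / (∏ j, (n j : ℝ)) ^ ((7 : ℝ) / 8)) *
                    Real.cos (8 * π * alphaRS n i * x ^ ((1 : ℝ) / 4) - π * betaRS i / 4)
                 else 0)| ≤
        C * T ^ (3 / 4 + 9 * (k : ℝ) / 8 + ε) * y ^ ((4 : ℝ) ^ (k - 2) - 5 / 4 + (k : ℝ) / 8) := by
  have hk3 : 3 ≤ k := by omega
  obtain ⟨m, rfl⟩ : ∃ m, k = m + 1 := ⟨k - 1, by omega⟩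
  have hm : 2 ≤ m := by omega
  obtain ⟨K, hK, hcK⟩ := hc (ε / (m + 1 : ℕ)) (by positivity)
  set p : ℝ := (9 * (m + 1 : ℕ) : ℝ) / 8 with hp
  have hp0 : 0 ≤ p := by positivity
  have hp1 : 1 / 4 ≤ p := by
    have : (1 : ℝ) ≤ (m + 1 : ℕ) := by simp
    linarith
  set D : ℝ := 8 ^ (m + 2) + (m + 1 : ℕ) ^ (4 ^ m) * 8 ^ m with hD
  set F := Finset.univ.filter (fun i : Fin (m + 1) → Bool => i ⟨0, by omega⟩ = false) with hF
  set Q : ℝ := 4 * (p + 3) * 2 ^ (p + 3 / 4) with hQ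
  refine ⟨#F * (K ^ (m + 1) * Q * D) + 1, by positivity, fun T y hT hy hyT => ?_⟩
  have hT0 : 0 < T := by linarith
  have hy0 : 0 < y := by linarith
  set E : ℝ := (4 : ℝ) ^ (m + 1 - 2) - 5 / 4 + ((m + 1 : ℕ) : ℝ) / 8 with hE
  have hTpow : T ^ (3 / 4 + 9 * ((m + 1 : ℕ) : ℝ) / 8 + ε) = T ^ (p + 3 / 4) * T ^ ε := by
    rw [← Real.rpow_add hT0, hp]
    congr 1
    ring
  have hcont : ∀ (i : Fin (m + 1) → Bool) (n : Fin (m + 1) → ℕ), Continuous fun x : ℝ =>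
      x ^ p * (if alphaRS n i ≠ 0 then
        ((∏ j, c (n j)) / (∏ j, (n j : ℝ)) ^ ((7 : ℝ) / 8)) *
          Real.cos (8 * π * alphaRS n i * x ^ ((1 : ℝ) / 4) - π * betaRS i / 4) else 0) := by
    intro i n
    have h1 : Continuous fun x : ℝ => x ^ p := Real.continuous_rpow_const hp0
    have h2 : Continuous fun x : ℝ => x ^ ((1 : ℝ) / 4) := Real.continuous_rpow_const (by norm_num)
    split_ifs <;> fun_prop
  simp only [Finset.mul_sum]
  rw [intervalIntegral.integral_finsetSum fun i _ => (continuous_finsetSum _ fun n _ =>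
    hcont i n).intervalIntegrable _ _]
  have hi : ∀ i ∈ F, |∫ x in T..(2 * T),
      ∑ n ∈ Fintype.piFinset (fun _ : Fin (m + 1) => Finset.Icc 1 ⌊y⌋₊),
        x ^ p * (if alphaRS n i ≠ 0 then
          ((∏ j, c (n j)) / (∏ j, (n j : ℝ)) ^ ((7 : ℝ) / 8)) *
            Real.cos (8 * π * alphaRS n i * x ^ ((1 : ℝ) / 4) - π * betaRS i / 4) else 0)| ≤
      K ^ (m + 1) * Q * D * (T ^ (p + 3 / 4) * T ^ ε * y ^ E) := by
    intro i _
    rw [intervalIntegral.integral_finsetSum fun n _ => (hcont i n).intervalIntegrable _ _]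
    refine (Finset.abs_sum_le_sum_abs _ _).trans ?_
    calc _ ≤ ∑ n ∈ Fintype.piFinset (fun _ : Fin (m + 1) => Finset.Icc 1 ⌊y⌋₊),
          K ^ (m + 1) * T ^ ε * Q * T ^ (p + 3 / 4) *
          (if alphaRS n i ≠ 0 then
            (∏ j, (n j : ℝ) ^ (-(7 / 8) : ℝ)) / |alphaRS n i| else 0) := by
          refine Finset.sum_le_sum fun n hn => ?_
          rw [Fintype.mem_piFinset] at hn
          simp only [Finset.mem_Icc, Nat.le_floor_iff hy0.le] at hn
          exact abs_integral_term_le hc0 (by linarith)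
            (prod_coeff_le hc0 hε.le hcK (by omega) hK hT0.le
              fun j => ⟨(hn j).1, (hn j).2.trans hyT⟩) i hp1 _
      _ ≤ K ^ (m + 1) * T ^ ε * Q * T ^ (p + 3 / 4) * (D * y ^ E) := by
          rw [← Finset.mul_sum]
          gcongr
          exact sum_prod_div_abs_alphaRS_le hm i (by linarith)
      _ = _ := by ring
  refine (Finset.abs_sum_le_sum_abs _ _).trans ((Finset.sum_le_card_nsmul _ _ _ hi).trans ?_)
  rw [nsmul_eq_mul, hTpow]
  have : 0 ≤ T ^ (p + 3 / 4) * T ^ ε * y ^ E := by positivity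
  linarith
end

section
/- Let k ≥ 3 be an integer and let i = (i₁,…,i_{k−1}) ∈ {0,1}^{k−1} with i ≠ (0,…,0). There is a constant C_k > 0 depending only on k such that for all real numbers N₁,…,N_k ≥ 1 with H = max(N₁,…,N_k), one has ∑ 1/|α(n;i)| ≤ C_k · N₁⋯N_k · H^{4^{k−2} − 5/4}, where the sum runs over all k-tuples (n₁,…,n_k) of positive integers with N_j < n_j ≤ 2N_j for 1 ≤ j ≤ k and α(n;i) ≠ 0. -/
open scoped Classical
open Real Finset

/-- A nonzero algebraic integer whose conjugates all lie in a finite set `T` of complex numbers of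
norm at most `B` satisfies the Liouville-type bound `1 ≤ ‖γ‖ * B ^ (#T - 1)`. -/
theorem one_le_norm_mul_pow_of_conjugates {γ : ℂ} (hγ : IsIntegral ℤ γ) (h0 : γ ≠ 0)
    {T : Finset ℂ} (hT : ∀ z : ℂ, Polynomial.aeval z (minpoly ℚ γ) = 0 → z ∈ T)
    {B : ℝ} (hB : 1 ≤ B) (hTB : ∀ z ∈ T, ‖z‖ ≤ B) :
    1 ≤ ‖γ‖ * B ^ (#T - 1) := by
  have hγQ : IsIntegral ℚ γ := hγ.tower_top
  have hmap := minpoly.isIntegrallyClosed_eq_field_fractions' ℚ hγ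
  set p : Polynomial ℂ := (minpoly ℚ γ).map (algebraMap ℚ ℂ) with hp
  have hpm : p.Monic := (minpoly.monic hγQ).map _
  have hsep : p.Separable := (minpoly.irreducible hγQ).separable.map
  have hsplit : p.Splits := IsAlgClosed.splits p
  have hnd : p.roots.Nodup := Polynomial.nodup_roots hsep
  have hprod : ‖p.coeff 0‖ = ∏ z ∈ p.roots.toFinset, ‖z‖ := by
    rw [hsplit.coeff_zero_eq_prod_roots_of_monic hpm, norm_mul, norm_pow, norm_neg, norm_one,
      one_pow, one_mul, ← norm_prod]
    congr 1
    rw [Finset.prod_eq_multiset_prod, Multiset.toFinset_val, hnd.dedup, Multiset.map_id']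
  have hcoeff : 1 ≤ ‖p.coeff 0‖ := by
    have h1 : p.coeff 0 = (((minpoly ℤ γ).coeff 0 : ℤ) : ℂ) := by
      rw [hp, hmap]; simp
    have h2 : (minpoly ℤ γ).coeff 0 ≠ 0 := fun h => by
      have h3 : (minpoly ℚ γ).coeff 0 = 0 := by rw [hmap, Polynomial.coeff_map, h, map_zero]
      exact minpoly.coeff_zero_ne_zero hγQ h0 h3
    rw [h1, Complex.norm_intCast]
    exact_mod_cast Int.one_le_abs h2
  have hmem : γ ∈ p.roots.toFinset := by
    rw [Multiset.mem_toFinset, Polynomial.mem_roots hpm.ne_zero, Polynomial.IsRoot.def, hp,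
      Polynomial.eval_map_algebraMap, minpoly.aeval]
  have hsub : p.roots.toFinset ⊆ T := by
    intro z hz
    rw [Multiset.mem_toFinset, Polynomial.mem_roots hpm.ne_zero, Polynomial.IsRoot.def, hp,
      Polynomial.eval_map_algebraMap] at hz
    exact hT z hz
  rw [hprod, ← Finset.mul_prod_erase _ _ hmem] at hcoeff
  refine hcoeff.trans ?_
  gcongr
  calc ∏ z ∈ p.roots.toFinset.erase γ, ‖z‖
      ≤ B ^ #(p.roots.toFinset.erase γ) :=
        (Finset.prod_le_prod (fun _ _ => norm_nonneg _)
          fun z hz => hTB z (hsub (Finset.mem_of_mem_erase hz))).trans_eq (Finset.prod_const B)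
    _ ≤ B ^ (#T - 1) := by
        rw [Finset.card_erase_of_mem hmem]
        exact pow_le_pow_right₀ hB (Nat.sub_le_sub_right (Finset.card_le_card hsub) 1)

/-- Every conjugate of `(∑ j, e j * r j) ^ 4`, where the `r j` are fourth roots of natural numbers,
is obtained by twisting the `r j` with `j ≠ j₀` by fourth roots of unity. -/
theorem exists_twist_of_aeval_minpoly_eq_zero {ι : Type*} [Fintype ι] (j₀ : ι) (r : ι → ℂ)
    (n : ι → ℕ) (hn : ∀ j, n j ≠ 0) (hr : ∀ j, r j ^ 4 = n j) (e : ι → ℤ) {z : ℂ}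
    (hz : Polynomial.aeval z (minpoly ℚ ((∑ j, (e j : ℂ) * r j) ^ 4)) = 0) :
    ∃ ζ : ι → ℂ, ζ j₀ = 1 ∧ (∀ j, ζ j ^ 4 = 1) ∧ z = (∑ j, ζ j * ((e j : ℂ) * r j)) ^ 4 := by
  have hr0 : ∀ j, r j ≠ 0 := fun j h => hn j (by simpa [h] using (hr j).symm)
  have hinteg : ∀ j, IsIntegral ℚ (r j) := fun j =>
    IsIntegral.of_pow (n := 4) (by norm_num) (by
      rw [hr]; exact_mod_cast isIntegral_algebraMap (R := ℚ) (A := ℂ) (x := (n j : ℚ)))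
  have hrmem : ∀ j, r j ∈ IntermediateField.adjoin ℚ (Set.range r) := fun j =>
    IntermediateField.subset_adjoin _ _ ⟨j, rfl⟩
  let R : ι → IntermediateField.adjoin ℚ (Set.range r) := fun j => ⟨r j, hrmem j⟩
  have hcoe : (((∑ j, (e j : IntermediateField.adjoin ℚ (Set.range r)) * R j) ^ 4 :
      IntermediateField.adjoin ℚ (Set.range r)) : ℂ) = (∑ j, (e j : ℂ) * r j) ^ 4 := by
    simp [R]
  obtain ⟨φ, hφ⟩ := IntermediateField.exists_algHom_adjoin_of_splits_of_aeval (F := ℚ) (K := ℂ)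
    (S := Set.range r) (by rintro _ ⟨j, rfl⟩; exact ⟨hinteg j, IsAlgClosed.splits _⟩)
    (hcoe ▸ SetLike.coe_mem _) hz
  have hφR : ∀ j, φ (R j) ^ 4 = n j := fun j => by
    have : R j ^ 4 = (n j : IntermediateField.adjoin ℚ (Set.range r)) :=
      Subtype.ext (by simpa [R] using hr j)
    rw [← map_pow, this, map_natCast]
  have hφ0 : ∀ j, φ (R j) ≠ 0 := fun j h => hn j (by simpa [h] using (hφR j).symm)
  have hdiv : ∀ j, (φ (R j) / r j) ^ 4 = 1 := fun j => by
    rw [div_pow, hφR, hr, div_self (by exact_mod_cast hn j)]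
  refine ⟨fun j => (φ (R j) / r j) / (φ (R j₀) / r j₀),
    div_self (div_ne_zero (hφ0 _) (hr0 _)), fun j => by rw [div_pow, hdiv, hdiv, div_one], ?_⟩
  have hzφ : z = (∑ j, (e j : ℂ) * φ (R j)) ^ 4 := by
    rw [← hφ]
    have : (⟨(∑ j, (e j : ℂ) * r j) ^ 4, hcoe ▸ SetLike.coe_mem _⟩ :
        IntermediateField.adjoin ℚ (Set.range r)) = (∑ j, (e j : _) * R j) ^ 4 :=
      Subtype.ext hcoe.symm
    rw [this]
    simp
  have hsum : ∑ j, (φ (R j) / r j) / (φ (R j₀) / r j₀) * ((e j : ℂ) * r j)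
      = (∑ j, (e j : ℂ) * φ (R j)) / (φ (R j₀) / r j₀) := by
    rw [Finset.sum_div]
    refine Finset.sum_congr rfl fun j _ => ?_
    have := hr0 j
    field_simp
  rw [hsum, div_pow, hdiv, div_one, hzφ]

/-- A nonzero signed sum `α` of `k` real fourth roots `x j` of positive integers satisfies
`1 ≤ |α| * (∑ j, x j) ^ (4 ^ (k - 1) - 1)`. -/
theorem one_le_abs_signed_sum_mul_pow {ι : Type*} [Fintype ι] (j₀ : ι) (x : ι → ℝ)
    (n : ι → ℕ) (hn : ∀ j, n j ≠ 0) (hx : ∀ j, 1 ≤ x j) (hxn : ∀ j, x j ^ 4 = n j)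
    (e : ι → ℤ) (he : ∀ j, |e j| = 1) (h0 : ∑ j, (e j : ℝ) * x j ≠ 0) :
    1 ≤ |∑ j, (e j : ℝ) * x j| * (∑ j, x j) ^ (4 ^ (Fintype.card ι - 1) - 1) := by
  set M := ∑ j, x j with hM
  have hx0 : ∀ j, 0 ≤ x j := fun j => zero_le_one.trans (hx j)
  have hM1 : 1 ≤ M :=
    (hx j₀).trans (Finset.single_le_sum (fun j _ => hx0 j) (Finset.mem_univ j₀))
  have hr : ∀ j, ((x j : ℂ)) ^ 4 = n j := fun j => by exact_mod_cast congrArg Complex.ofReal (hxn j)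
  have hcast : (∑ j, (e j : ℂ) * (x j : ℂ)) = ((∑ j, (e j : ℝ) * x j : ℝ) : ℂ) := by
    push_cast; rfl
  have hinteg : IsIntegral ℤ ((∑ j, (e j : ℂ) * (x j : ℂ)) ^ 4) := by
    refine (IsIntegral.sum _ fun j _ => IsIntegral.mul ?_ ?_).pow 4
    · exact isIntegral_algebraMap (R := ℤ) (A := ℂ) (x := e j)
    · refine IsIntegral.of_pow (n := 4) (by norm_num) ?_
      rw [hr]
      exact_mod_cast isIntegral_algebraMap (R := ℤ) (A := ℂ) (x := (n j : ℤ))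
  let Z : Finset (ι → ℂ) := Fintype.piFinset fun j =>
    if j = j₀ then {1} else Polynomial.nthRootsFinset 4 (1 : ℂ)
  let T : Finset ℂ := Z.image fun ζ => (∑ j, ζ j * ((e j : ℂ) * (x j : ℂ))) ^ 4
  have hZcard : #Z ≤ 4 ^ (Fintype.card ι - 1) := by
    rw [Fintype.card_piFinset, ← Finset.mul_prod_erase _ _ (Finset.mem_univ j₀), if_pos rfl,
      Finset.card_singleton, one_mul, ← Finset.card_univ,
      ← Finset.card_erase_of_mem (Finset.mem_univ j₀)]
    refine Finset.prod_le_pow_card _ _ _ fun j hj => ?_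
    rw [if_neg (Finset.ne_of_mem_erase hj)]
    exact (Multiset.toFinset_card_le _).trans (Polynomial.card_nthRoots 4 1)
  have hT : ∀ z : ℂ, Polynomial.aeval z (minpoly ℚ ((∑ j, (e j : ℂ) * (x j : ℂ)) ^ 4)) = 0 →
      z ∈ T := by
    intro z hz
    obtain ⟨ζ, h1, h4, rfl⟩ := exists_twist_of_aeval_minpoly_eq_zero j₀ _ n hn hr e hz
    refine Finset.mem_image.2 ⟨ζ, Fintype.mem_piFinset.2 fun j => ?_, rfl⟩
    split_ifs with h
    · simp [h, h1]
    · simpa [Polynomial.mem_nthRootsFinset (show 0 < 4 by norm_num)] using h4 j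
  have hTB : ∀ z ∈ T, ‖z‖ ≤ M ^ 4 := by
    intro z hz
    obtain ⟨ζ, hζ, rfl⟩ := Finset.mem_image.1 hz
    have hζ4 : ∀ j, ‖ζ j‖ = 1 := fun j => by
      have h := Fintype.mem_piFinset.1 hζ j
      split_ifs at h with hj
      · simp [Finset.mem_singleton.1 h]
      · exact Complex.norm_eq_one_of_pow_eq_one
          ((Polynomial.mem_nthRootsFinset (show 0 < 4 by norm_num) _).1 h) (by norm_num)
    rw [norm_pow]
    gcongr
    refine norm_sum_le_of_le _ fun j _ => ?_
    have : |(e j : ℝ)| = 1 := by exact_mod_cast he j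
    simp [hζ4, this, abs_of_nonneg (hx0 j)]
  have key := one_le_norm_mul_pow_of_conjugates hinteg
    (by rw [hcast]; exact pow_ne_zero _ (by exact_mod_cast h0)) hT (one_le_pow₀ hM1) hTB
  have hle : #T - 1 ≤ 4 ^ (Fintype.card ι - 1) - 1 :=
    Nat.sub_le_sub_right (Finset.card_image_le.trans hZcard) 1
  have key' : 1 ≤ (|∑ j, (e j : ℝ) * x j| * M ^ (4 ^ (Fintype.card ι - 1) - 1)) ^ 4 := by
    calc (1 : ℝ) ≤ _ := key
      _ ≤ ‖(∑ j, (e j : ℂ) * (x j : ℂ)) ^ 4‖ * (M ^ 4) ^ (4 ^ (Fintype.card ι - 1) - 1) := by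
          gcongr
          exact one_le_pow₀ hM1
      _ = _ := by
          rw [hcast, norm_pow, Complex.norm_real, Real.norm_eq_abs, mul_pow, pow_right_comm]
  by_contra! hlt
  exact absurd key' (not_le.2 (pow_lt_one₀ (by positivity) hlt (by norm_num)))

/-- Fourth roots of distinct positive integers up to `2 * h ^ 4` are `1 / (8 * h ^ 3)`-separated. -/
theorem fourth_root_separation {a b h : ℝ} (ha : 0 ≤ a) (hb : 0 ≤ b) (hh : 0 < h)
    (hab : a ^ 4 + 1 ≤ b ^ 4) (hbh : b ^ 4 ≤ 2 * h ^ 4) : 1 / (8 * h ^ 3) ≤ b - a := by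
  have hlt : a < b := lt_of_pow_lt_pow_left₀ 4 hb (by linarith)
  have hb3 : b ^ 3 ≤ 2 * h ^ 3 := by
    refine le_of_pow_le_pow_left₀ (n := 4) (by norm_num) (by positivity) ?_
    calc (b ^ 3) ^ 4 = (b ^ 4) ^ 3 := by ring
      _ ≤ (2 * h ^ 4) ^ 3 := by gcongr
      _ ≤ (2 * h ^ 3) ^ 4 := by nlinarith [pow_pos hh 12]
  rw [div_le_iff₀ (by positivity)]
  calc 1 ≤ (b - a) * ((b + a) * (b ^ 2 + a ^ 2)) := by linarith
    _ ≤ (b - a) * ((b + b) * (b ^ 2 + b ^ 2)) := by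
        have := sub_nonneg.2 hlt.le
        gcongr
    _ = (b - a) * (4 * b ^ 3) := by ring
    _ ≤ (b - a) * (8 * h ^ 3) := by
        refine mul_le_mul_of_nonneg_left ?_ (sub_nonneg.2 hlt.le)
        linarith

theorem rpow_one_div_four_pow_four {x : ℝ} (hx : 0 ≤ x) : (x ^ ((1 : ℝ) / 4)) ^ 4 = x := by
  rw [← Real.rpow_natCast, ← Real.rpow_mul hx]
  norm_num

/-- Fixing all coordinates but the one at `j₀`, at most one value of `n j₀` makes `alphaRS n i`
smaller than `1 / (16 * h ^ 3)`. -/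
theorem eq_of_abs_alphaRS_lt {k : ℕ} {i : Fin k → Bool} {j₀ : Fin k} {n m : Fin k → ℕ} {h : ℝ}
    (hh : 0 < h) (hoff : ∀ j, j ≠ j₀ → n j = m j) (hn : (n j₀ : ℝ) ≤ 2 * h ^ 4)
    (hm : (m j₀ : ℝ) ≤ 2 * h ^ 4) (hna : |alphaRS n i| < 1 / (16 * h ^ 3))
    (hma : |alphaRS m i| < 1 / (16 * h ^ 3)) : n = m := by
  have hdiff : alphaRS n i - alphaRS m i = (if i j₀ then (-1 : ℝ) else 1) *
      ((n j₀ : ℝ) ^ ((1 : ℝ) / 4) - (m j₀ : ℝ) ^ ((1 : ℝ) / 4)) := by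
    rw [alphaRS, alphaRS, ← Finset.sum_sub_distrib, Finset.sum_eq_single j₀]
    · ring
    · intro j _ hj
      rw [hoff j hj, sub_self]
    · simp
  have habs : |(n j₀ : ℝ) ^ ((1 : ℝ) / 4) - (m j₀ : ℝ) ^ ((1 : ℝ) / 4)| < 1 / (8 * h ^ 3) := by
    have hsign : |(if i j₀ then (-1 : ℝ) else 1)| = 1 := by split_ifs <;> simp
    calc _ = |alphaRS n i - alphaRS m i| := by rw [hdiff, abs_mul, hsign, one_mul]
      _ ≤ |alphaRS n i| + |alphaRS m i| := abs_sub _ _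
      _ < 1 / (16 * h ^ 3) + 1 / (16 * h ^ 3) := add_lt_add hna hma
      _ = 1 / (8 * h ^ 3) := by field_simp; norm_num
  have hsep : ∀ p q : ℕ, p < q → (q : ℝ) ≤ 2 * h ^ 4 →
      1 / (8 * h ^ 3) ≤ (q : ℝ) ^ ((1 : ℝ) / 4) - (p : ℝ) ^ ((1 : ℝ) / 4) := by
    intro p q hpq hq
    refine fourth_root_separation (by positivity) (by positivity) hh ?_ ?_
    · rw [rpow_one_div_four_pow_four p.cast_nonneg, rpow_one_div_four_pow_four q.cast_nonneg]
      exact_mod_cast hpq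
    · rwa [rpow_one_div_four_pow_four q.cast_nonneg]
  rw [abs_lt] at habs
  ext j
  by_cases hj : j = j₀
  · subst hj
    rcases lt_trichotomy (n j) (m j) with hlt | heq | hlt
    · linarith [hsep _ _ hlt hm]
    · exact heq
    · linarith [hsep _ _ hlt hn]
  · exact hoff j hj

/-- If `alphaRS n i ≠ 0` and the entries of `n` are at most `2 * h ^ 4`, then
`1 / |alphaRS n i| ≤ (2 * k * h) ^ (4 ^ (k - 1) - 1)`. -/
theorem one_div_abs_alphaRS_le {k : ℕ} (j₀ : Fin k) {i : Fin k → Bool} {n : Fin k → ℕ} {h : ℝ}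
    (hh : 0 ≤ h) (hn0 : ∀ j, n j ≠ 0) (hn : ∀ j, (n j : ℝ) ≤ 2 * h ^ 4)
    (h0 : alphaRS n i ≠ 0) : 1 / |alphaRS n i| ≤ (2 * k * h) ^ (4 ^ (k - 1) - 1) := by
  have heq : alphaRS n i =
      ∑ j, ((if i j then -1 else 1 : ℤ) : ℝ) * (n j : ℝ) ^ ((1 : ℝ) / 4) := by
    simp [alphaRS]
  have key := one_le_abs_signed_sum_mul_pow j₀ (fun j => (n j : ℝ) ^ ((1 : ℝ) / 4)) n hn0
    (fun j => Real.one_le_rpow (by exact_mod_cast Nat.one_le_iff_ne_zero.2 (hn0 j)) (by norm_num))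
    (fun j => rpow_one_div_four_pow_four (n j).cast_nonneg) (fun j => if i j then -1 else 1)
    (fun j => by split_ifs <;> simp) (heq ▸ h0)
  rw [← heq, Fintype.card_fin] at key
  rw [div_le_iff₀' (abs_pos.2 h0)]
  refine key.trans ?_
  gcongr
  calc ∑ j, (n j : ℝ) ^ ((1 : ℝ) / 4) ≤ ∑ _j : Fin k, 2 * h := by
        refine Finset.sum_le_sum fun j _ => ?_
        refine le_of_pow_le_pow_left₀ (n := 4) (by norm_num) (by positivity) ?_
        rw [rpow_one_div_four_pow_four (n j).cast_nonneg]
        nlinarith [hn j, pow_nonneg hh 4]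
    _ = 2 * k * h := by simp; ring

theorem card_Ioc_floor_le {x : ℝ} (hx : 0 ≤ x) : (#(Finset.Ioc ⌊x⌋₊ ⌊2 * x⌋₊) : ℝ) ≤ 2 * x := by
  rw [Nat.card_Ioc]
  exact (Nat.cast_le.2 (Nat.sub_le _ _)).trans (Nat.floor_le (by positivity))

/-- The box of `n` with `N j < n j ≤ 2 * N j` contains few `n` with `alphaRS n i` very small. -/
theorem card_filter_abs_alphaRS_lt_le {k : ℕ} (i : Fin k → Bool) (j₀ : Fin k) {N : Fin k → ℝ}
    (hN : ∀ j, 1 ≤ N j) {h : ℝ} (hh : 0 < h) (hhN : h ^ 4 = N j₀) :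
    (#{n ∈ Fintype.piFinset (fun j : Fin k => Finset.Ioc ⌊N j⌋₊ ⌊2 * N j⌋₊) |
      |alphaRS n i| < 1 / (16 * h ^ 3)} : ℝ) ≤ 2 ^ k * (∏ j, N j) / h ^ 4 := by
  set P := Fintype.piFinset (fun j : Fin k => Finset.Ioc ⌊N j⌋₊ ⌊2 * N j⌋₊) with hP
  have hN0 : ∀ j, 0 ≤ N j := fun j => zero_le_one.trans (hN j)
  let Q : Finset (Fin k → ℕ) := Fintype.piFinset fun j =>
    if j = j₀ then {0} else Finset.Ioc ⌊N j⌋₊ ⌊2 * N j⌋₊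
  have hle : ∀ n ∈ P, (n j₀ : ℝ) ≤ 2 * h ^ 4 := fun n hn => by
    have := (Finset.mem_Ioc.1 (Fintype.mem_piFinset.1 hn j₀)).2
    rw [hhN]
    exact (Nat.cast_le.2 this).trans (Nat.floor_le (by linarith [hN0 j₀]))
  have hcard : #{n ∈ P | |alphaRS n i| < 1 / (16 * h ^ 3)} ≤ #Q := by
    refine Finset.card_le_card_of_injOn (fun n => Function.update n j₀ 0) ?_ ?_
    · intro n hn
      have hnP := (Finset.mem_filter.1 hn).1
      refine Finset.mem_coe.2 (Fintype.mem_piFinset.2 fun j => ?_)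
      by_cases hj : j = j₀
      · subst hj
        simp
      · simpa [hj] using Fintype.mem_piFinset.1 hnP j
    · intro n hn m hm hnm
      obtain ⟨hnP, hna⟩ := Finset.mem_filter.1 hn
      obtain ⟨hmP, hma⟩ := Finset.mem_filter.1 hm
      refine eq_of_abs_alphaRS_lt hh (fun j hj => ?_) (hle n hnP) (hle m hmP) hna hma
      simpa [hj] using congrFun hnm j
  have hQ : (#Q : ℝ) ≤ ∏ j ∈ Finset.univ.erase j₀, 2 * N j := by
    rw [Fintype.card_piFinset, ← Finset.mul_prod_erase _ _ (Finset.mem_univ j₀), if_pos rfl,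
      Finset.card_singleton, one_mul, Nat.cast_prod]
    refine Finset.prod_le_prod (fun _ _ => Nat.cast_nonneg _) fun j hj => ?_
    rw [if_neg (Finset.ne_of_mem_erase hj)]
    exact card_Ioc_floor_le (hN0 j)
  refine (Nat.cast_le.2 hcard).trans (hQ.trans ?_)
  have hprod : 2 ^ k * ∏ j, N j = (2 * N j₀) * ∏ j ∈ Finset.univ.erase j₀, 2 * N j := by
    rw [Finset.mul_prod_erase _ (fun j => 2 * N j) (Finset.mem_univ j₀), Finset.prod_mul_distrib]
    simp
  have hpos : 0 ≤ ∏ j ∈ Finset.univ.erase j₀, 2 * N j :=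
    Finset.prod_nonneg fun j _ => by linarith [hN0 j]
  rw [le_div_iff₀ (by positivity), hprod, hhN]
  nlinarith [mul_nonneg (hN0 j₀) hpos]

theorem stmt_10 (k : ℕ) (hk : 3 ≤ k) :
    ∃ C : ℝ, 0 < C ∧ ∀ (i : Fin k → Bool), i ⟨0, by omega⟩ = false → i ≠ (fun _ => false) →
      ∀ N : Fin k → ℝ, (∀ j, 1 ≤ N j) →
      (∑ n ∈ Fintype.piFinset (fun j : Fin k => Finset.Ioc ⌊N j⌋₊ ⌊2 * N j⌋₊),
          (if alphaRS n i ≠ 0 then 1 / |alphaRS n i| else 0)) ≤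
        C * (∏ j, N j) * (⨆ j, N j) ^ ((4 : ℝ) ^ (k - 2) - 5 / 4) := by
  refine ⟨2 ^ k * (16 + (2 * k) ^ (4 ^ (k - 1) - 1)), by positivity, fun i _ _ N hN => ?_⟩
  have : Nonempty (Fin k) := ⟨⟨0, by omega⟩⟩
  obtain ⟨j₀, hj₀⟩ := exists_eq_ciSup_of_finite (f := N)
  have hNle : ∀ j, N j ≤ N j₀ := fun j => hj₀ ▸ le_ciSup (Set.finite_range N).bddAbove j
  have hN0 : ∀ j, 0 ≤ N j := fun j => zero_le_one.trans (hN j)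
  rw [← hj₀]
  set h : ℝ := N j₀ ^ ((1 : ℝ) / 4) with hdef
  have hh1 : 1 ≤ h := Real.one_le_rpow (hN j₀) (by norm_num)
  have hh : 0 < h := by positivity
  have hhN : h ^ 4 = N j₀ := rpow_one_div_four_pow_four (hN0 j₀)
  obtain ⟨E, hE, hE3⟩ : ∃ E, 4 ^ (k - 1) - 1 = E + 4 ∧ 3 ≤ E := by
    have : 4 ^ 2 ≤ 4 ^ (k - 1) := Nat.pow_le_pow_right (by norm_num) (by omega)
    exact ⟨4 ^ (k - 1) - 5, by omega, by omega⟩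
  have hexp : N j₀ ^ ((4 : ℝ) ^ (k - 2) - 5 / 4) = h ^ E := by
    rw [hdef, ← Real.rpow_natCast (N j₀ ^ ((1 : ℝ) / 4)), ← Real.rpow_mul (hN0 j₀)]
    congr 1
    have h1 : (4 : ℝ) ^ (k - 1) = E + 5 := by
      have : 4 ^ (k - 1) = E + 5 := by omega
      exact_mod_cast this
    have h2 : (4 : ℝ) ^ (k - 1) = 4 ^ (k - 2) * 4 := by
      rw [← pow_succ]
      congr 1
      omega
    linarith
  rw [hexp]
  set P := Fintype.piFinset (fun j : Fin k => Finset.Ioc ⌊N j⌋₊ ⌊2 * N j⌋₊) with hP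
  set L : ℝ := (2 * k * h) ^ (4 ^ (k - 1) - 1) with hL
  have hL0 : 0 ≤ L := by positivity
  have hterm : ∀ n ∈ P, (if alphaRS n i ≠ 0 then 1 / |alphaRS n i| else 0) ≤
      16 * h ^ 3 + if |alphaRS n i| < 1 / (16 * h ^ 3) then L else 0 := by
    intro n hn
    have hmem := fun j => Finset.mem_Ioc.1 (Fintype.mem_piFinset.1 hn j)
    by_cases h0 : alphaRS n i ≠ 0
    · rw [if_pos h0]
      split_ifs with hlt
      · have := one_div_abs_alphaRS_le j₀ hh.le (fun j => (Nat.zero_lt_of_lt (hmem j).1).ne')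
          (fun j => ?_) h0
        · exact this.trans (le_add_of_nonneg_left (by positivity))
        · rw [hhN]
          exact (Nat.cast_le.2 (hmem j).2).trans
            ((Nat.floor_le (by linarith [hN0 j])).trans (by linarith [hNle j]))
      · rw [add_zero]
        exact one_div_le (by positivity) (abs_pos.2 h0) |>.1 (not_lt.1 hlt)
    · rw [if_neg h0]
      positivity
  have hPcard : (#P : ℝ) ≤ 2 ^ k * ∏ j, N j := by
    rw [hP, Fintype.card_piFinset, Nat.cast_prod]
    calc _ ≤ ∏ j, 2 * N j :=
          Finset.prod_le_prod (fun _ _ => Nat.cast_nonneg _) fun j _ => card_Ioc_floor_le (hN0 j)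
      _ = _ := by simp [Finset.prod_mul_distrib]
  have hprod : 0 ≤ ∏ j, N j := Finset.prod_nonneg fun j _ => hN0 j
  calc _ ≤ ∑ n ∈ P, (16 * h ^ 3 + if |alphaRS n i| < 1 / (16 * h ^ 3) then L else 0) :=
        Finset.sum_le_sum hterm
    _ = #P * (16 * h ^ 3) + #{n ∈ P | |alphaRS n i| < 1 / (16 * h ^ 3)} * L := by
        rw [Finset.sum_add_distrib, ← Finset.sum_filter]
        simp only [Finset.sum_const, nsmul_eq_mul]
    _ ≤ (2 ^ k * ∏ j, N j) * (16 * h ^ E) + (2 ^ k * (∏ j, N j) / h ^ 4) * L := by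
        gcongr
        · exact card_filter_abs_alphaRS_lt_le i j₀ hN hh hhN
    _ = _ := by
        rw [hL, hE, mul_pow (2 * (k : ℝ)) h, pow_add h]
        field_simp
end
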